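/- arXiv:2512.00320 — 5 statements merged into one kernel-verified Lean document; each statement's English description precedes it below -/
import Mathlib

section
/- Let N be a positive integer, h = 1/N, and for j = 1,…,N let J_j = [(j−1)h, jh] and fix points x_j* ∈ J_j; let I_h be the associated nodal-value interpolant. Let ν, γ, δ, μ be positive constants satisfying ν ≥ μh²/2 and μ ≥ 2(γ+ν), and let α satisfy 0 < α ≤ (μ − 2γ − 2ν)/2. Set β = 2ν − μh² and β₁ = μ − 2γ − 2ν − 2α. Suppose y : [0,1] × [0,∞) → ℝ is continuous, with continuous partial derivatives y_t, y_x, y_xx on [0,1] × [0,∞), satisfies the controlled Chafee–Infante equation y_t(x,t) = ν y_xx(x,t) + γ y(x,t) − δ y(x,t)³ − μ (I_h y(·,t))(x) for all x ∈ (0,1), t > 0, together with the boundary conditions y(0,t) = 0 and y_x(1,t) = 0 for all t ≥ 0. Then for every t ≥ 0: ∫₀¹ y(x,t)² dx + e^{−2αt} ∫₀ᵗ e^{2αs} [ β ∫₀¹ y_x(x,s)² dx + 2δ ∫₀¹ y(x,s)⁴ dx + β₁ ∫₀¹ y(x,s)² dx ] ds ≤ e^{−2αt} ∫₀¹ y(x,0)²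 dx. -/
open Set intervalIntegral

/-- Cauchy–Schwarz against the constant function on an interval. -/
lemma sq_integral_le_length_mul_integral_sq {f : ℝ → ℝ} (hf : Continuous f) {a b : ℝ}
    (hab : a ≤ b) : (∫ x in a..b, f x) ^ 2 ≤ (b - a) * ∫ x in a..b, f x ^ 2 := by
  rcases hab.eq_or_lt with rfl | hlt
  · simp
  set m := ∫ x in a..b, f x with hm
  have hexpand : ∫ x in a..b, ((b - a) * f x - m) ^ 2 =
      (b - a) * ((b - a) * (∫ x in a..b, f x ^ 2) - m ^ 2) := by
    have hpoint : ∀ x, ((b - a) * f x - m) ^ 2 =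
        (b - a) ^ 2 * f x ^ 2 - 2 * (b - a) * m * f x + m ^ 2 := fun x => by ring
    simp_rw [hpoint]
    rw [integral_add (Continuous.intervalIntegrable (by fun_prop) _ _) (by simp),
      integral_sub (Continuous.intervalIntegrable (by fun_prop) _ _)
        (Continuous.intervalIntegrable (by fun_prop) _ _),
      integral_const_mul, integral_const_mul, integral_const, ← hm, smul_eq_mul]
    ring
  have hnonneg : 0 ≤ ∫ x in a..b, ((b - a) * f x - m) ^ 2 :=
    integral_nonneg hab fun x _ => sq_nonneg _
  rw [hexpand] at hnonneg
  linarith [nonneg_of_mul_nonneg_right hnonneg (sub_pos.2 hlt)]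

/-- The oscillation of a `C¹` function on an interval is controlled by the `L²` norm of its
derivative. -/
lemma sq_sub_le_length_mul_integral_deriv_sq {u u' : ℝ → ℝ} (hu : Continuous u)
    (hu' : Continuous u') {a b : ℝ} (hderiv : ∀ x ∈ Ioo a b, HasDerivAt u (u' x) x)
    {c x : ℝ} (hc : c ∈ Icc a b) (hx : x ∈ Icc a b) :
    (u x - u c) ^ 2 ≤ (b - a) * ∫ z in a..b, u' z ^ 2 := by
  wlog hcx : c ≤ x generalizing c x
  · rw [← neg_sub, neg_sq]
    exact this hx hc (le_of_not_ge hcx)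
  have hftc : ∫ z in c..x, u' z = u x - u c :=
    integral_eq_sub_of_hasDerivAt_of_le hcx hu.continuousOn
      (fun z hz => hderiv z ⟨hc.1.trans_lt hz.1, hz.2.trans_le hx.2⟩)
      (hu'.intervalIntegrable _ _)
  have hmono : ∫ z in c..x, u' z ^ 2 ≤ ∫ z in a..b, u' z ^ 2 :=
    integral_mono_interval hc.1 hcx hx.2 (.of_forall fun z => sq_nonneg _)
      (Continuous.intervalIntegrable (by fun_prop) _ _)
  have hpos : 0 ≤ ∫ z in c..x, u' z ^ 2 := integral_nonneg hcx fun z _ => sq_nonneg _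
  rw [← hftc]
  refine (sq_integral_le_length_mul_integral_sq hu' hcx).trans ?_
  exact mul_le_mul (by linarith [hc.1, hx.2]) hmono hpos (by linarith [hc.1, hx.2])

/-- `L²` error of nodal-value interpolation on a single cell. -/
lemma integral_sub_node_sq_le {u u' g : ℝ → ℝ} (hu : Continuous u) (hu' : Continuous u')
    (hg : Continuous g) {a b : ℝ} (hab : a ≤ b)
    (hderiv : ∀ x ∈ Ioo a b, HasDerivAt u (u' x) x) {c : ℝ} (hc : c ∈ Icc a b)
    (hgc : ∀ x ∈ Ioo a b, g x = u c) :
    ∫ x in a..b, (u x - g x) ^ 2 ≤ (b - a) ^ 2 * ∫ x in a..b, u' x ^ 2 := by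
  have hle : ∫ x in a..b, (u x - g x) ^ 2 ≤
      ∫ _ in a..b, (b - a) * ∫ z in a..b, u' z ^ 2 := by
    refine integral_mono_on_of_le_Ioo hab (Continuous.intervalIntegrable (by fun_prop) _ _)
      (by simp) fun x hx => ?_
    rw [hgc x hx]
    exact sq_sub_le_length_mul_integral_deriv_sq hu hu' hderiv hc (Ioo_subset_Icc_self hx)
  refine hle.trans_eq ?_
  rw [integral_const, smul_eq_mul]
  ring

/-- `L²` error of nodal-value interpolation on the uniform mesh of size `1 / N`. -/
lemma integral_sub_interpolant_sq_le {N : ℕ} (hN : 0 < N) {h : ℝ} (hh : h = 1 / N)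
    {xstar : ℕ → ℝ}
    (hxstar : ∀ j : ℕ, 1 ≤ j → j ≤ N →
      xstar j ∈ Icc (((j : ℝ) - 1) * h) ((j : ℝ) * h))
    {u u' g : ℝ → ℝ} (hu : Continuous u) (hu' : Continuous u') (hg : Continuous g)
    (hderiv : ∀ x ∈ Ioo (0 : ℝ) 1, HasDerivAt u (u' x) x)
    (hgc : ∀ j : ℕ, 1 ≤ j → j ≤ N →
      ∀ x ∈ Ioo (((j : ℝ) - 1) * h) ((j : ℝ) * h), g x = u (xstar j)) :
    ∫ x in (0 : ℝ)..1, (u x - g x) ^ 2 ≤ h ^ 2 * ∫ x in (0 : ℝ)..1, u' x ^ 2 := by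
  have hN' : (0 : ℝ) < N := Nat.cast_pos.2 hN
  have hpos : 0 < h := by rw [hh]; positivity
  have hNh : (N : ℝ) * h = 1 := by rw [hh]; field_simp
  have hsplit : ∀ f : ℝ → ℝ, Continuous f → ∫ x in (0 : ℝ)..1, f x =
      ∑ k ∈ Finset.range N, ∫ x in (k : ℝ) * h..((k + 1 : ℕ) : ℝ) * h, f x := by
    intro f hf
    rw [sum_integral_adjacent_intervals (a := fun k : ℕ => (k : ℝ) * h)
      fun k _ => hf.intervalIntegrable _ _]
    simp [hNh]
  rw [hsplit (fun x => (u x - g x) ^ 2) (by fun_prop),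
    hsplit (fun x => u' x ^ 2) (by fun_prop), Finset.mul_sum]
  refine Finset.sum_le_sum fun k hk => ?_
  have hkN : k + 1 ≤ N := Finset.mem_range.1 hk
  have hright : ((k + 1 : ℕ) : ℝ) * h ≤ 1 := by
    rw [← hNh]
    exact mul_le_mul_of_nonneg_right (by exact_mod_cast hkN) hpos.le
  have hleft : 0 ≤ (k : ℝ) * h := by positivity
  have hpred : ((k + 1 : ℕ) : ℝ) - 1 = k := by push_cast; ring
  have hnode := hxstar (k + 1) (by omega) hkN
  have hconst := hgc (k + 1) (by omega) hkN
  rw [hpred] at hnode hconst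
  have hlen : ((k + 1 : ℕ) : ℝ) * h - k * h = h := by push_cast; ring
  have hcell := integral_sub_node_sq_le hu hu' hg (by linarith)
    (fun x hx => hderiv x ⟨hleft.trans_lt hx.1, hx.2.trans_le hright⟩) hnode hconst
  rwa [hlen] at hcell

/-- Integration by parts for `u u''` with mixed homogeneous boundary conditions. -/
lemma integral_mul_deriv2_eq_neg {u u' u'' : ℝ → ℝ} (hu : Continuous u) (hu' : Continuous u')
    (hu'' : Continuous u'') (hderiv : ∀ x ∈ Ioo (0 : ℝ) 1, HasDerivAt u (u' x) x)
    (hderiv' : ∀ x ∈ Ioo (0 : ℝ) 1, HasDerivAt u' (u'' x) x) (h0 : u 0 = 0) (h1 : u' 1 = 0) :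
    ∫ x in (0 : ℝ)..1, u x * u'' x = -∫ x in (0 : ℝ)..1, u' x ^ 2 := by
  have hftc : ∫ x in (0 : ℝ)..1, (u' x * u' x + u x * u'' x) = u 1 * u' 1 - u 0 * u' 0 :=
    integral_eq_sub_of_hasDerivAt_of_le zero_le_one (hu.mul hu').continuousOn
      (fun x hx => (hderiv x hx).mul (hderiv' x hx))
      (Continuous.intervalIntegrable (by fun_prop) _ _)
  rw [integral_add (Continuous.intervalIntegrable (by fun_prop) _ _)
    (Continuous.intervalIntegrable (by fun_prop) _ _), h0, h1] at hftc
  simp_rw [pow_two]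
  linarith

/-- Energy dissipation at a fixed time: `w` plays the role of the time derivative. -/
lemma two_mul_integral_mul_le_dissipation {N : ℕ} (hN : 0 < N) {h : ℝ} (hh : h = 1 / N)
    {xstar : ℕ → ℝ}
    (hxstar : ∀ j : ℕ, 1 ≤ j → j ≤ N →
      xstar j ∈ Icc (((j : ℝ) - 1) * h) ((j : ℝ) * h))
    {ν γ δ μ : ℝ} (hμ : 0 < μ) {u u' u'' w : ℝ → ℝ} (hu : Continuous u)
    (hu' : Continuous u') (hu'' : Continuous u'') (hw : Continuous w)
    (hderiv : ∀ x ∈ Ioo (0 : ℝ) 1, HasDerivAt u (u' x) x)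
    (hderiv' : ∀ x ∈ Ioo (0 : ℝ) 1, HasDerivAt u' (u'' x) x) (h0 : u 0 = 0) (h1 : u' 1 = 0)
    (hpde : ∀ j : ℕ, 1 ≤ j → j ≤ N → ∀ x ∈ Ioo (((j : ℝ) - 1) * h) ((j : ℝ) * h),
      w x = ν * u'' x + γ * u x - δ * u x ^ 3 - μ * u (xstar j)) :
    ∫ x in (0 : ℝ)..1, 2 * u x * w x ≤
      -((2 * ν - μ * h ^ 2) * (∫ x in (0 : ℝ)..1, u' x ^ 2) +
        2 * δ * (∫ x in (0 : ℝ)..1, u x ^ 4) +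
        (μ - 2 * γ) * ∫ x in (0 : ℝ)..1, u x ^ 2) := by
  set g : ℝ → ℝ := fun x => (ν * u'' x + γ * u x - δ * u x ^ 3 - w x) / μ with hgdef
  have hg : Continuous g := by fun_prop
  have hinterp := integral_sub_interpolant_sq_le hN hh hxstar hu hu' hg hderiv
    fun j hj hjN x hx => by
      simp only [hgdef, hpde j hj hjN x hx]
      field_simp
      ring
  have hparts := integral_mul_deriv2_eq_neg hu hu' hu'' hderiv hderiv' h0 h1
  have hle : ∫ x in (0 : ℝ)..1, 2 * u x * w x ≤
      ∫ x in (0 : ℝ)..1, (2 * ν * (u x * u'' x) + μ * (u x - g x) ^ 2 -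
        2 * δ * u x ^ 4 - (μ - 2 * γ) * u x ^ 2) := by
    refine integral_mono_on zero_le_one (Continuous.intervalIntegrable (by fun_prop) _ _)
      (Continuous.intervalIntegrable (by fun_prop) _ _) fun x _ => ?_
    have hwx : w x = ν * u'' x + γ * u x - δ * u x ^ 3 - μ * g x := by
      simp only [hgdef]
      field_simp
      ring
    rw [hwx]
    nlinarith [mul_nonneg hμ.le (sq_nonneg (g x))]
  rw [integral_sub (Continuous.intervalIntegrable (by fun_prop) _ _)
      (Continuous.intervalIntegrable (by fun_prop) _ _),
    integral_sub (Continuous.intervalIntegrable (by fun_prop) _ _)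
      (Continuous.intervalIntegrable (by fun_prop) _ _),
    integral_add (Continuous.intervalIntegrable (by fun_prop) _ _)
      (Continuous.intervalIntegrable (by fun_prop) _ _),
    integral_const_mul, integral_const_mul, integral_const_mul, integral_const_mul,
    hparts] at hle
  linarith [mul_le_mul_of_nonneg_left hinterp hμ.le]

/-- The weighted energy `e^{2αt} ∫₀¹ y(·,t)²` as the time integral of its derivative. -/
lemma exp_mul_integral_sq_sub_eq {y yt : ℝ → ℝ → ℝ}
    (hy : Continuous fun p : ℝ × ℝ => y p.1 p.2)
    (hyt : Continuous fun p : ℝ × ℝ => yt p.1 p.2)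
    (hderiv : ∀ x ∈ Icc (0 : ℝ) 1, ∀ s ∈ Ioi (0 : ℝ), HasDerivAt (y x) (yt x s) s)
    (α : ℝ) {t : ℝ} (ht : 0 ≤ t) :
    Real.exp (2 * α * t) * (∫ x in (0 : ℝ)..1, y x t ^ 2) - ∫ x in (0 : ℝ)..1, y x 0 ^ 2 =
      ∫ s in (0 : ℝ)..t, Real.exp (2 * α * s) *
        (2 * α * (∫ x in (0 : ℝ)..1, y x s ^ 2) + ∫ x in (0 : ℝ)..1, 2 * y x s * yt x s) := by
  have hys : ∀ s, Continuous fun x => y x s :=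
    fun s => hy.comp (by fun_prop : Continuous fun x => (x, s))
  have hyts : ∀ s, Continuous fun x => yt x s :=
    fun s => hyt.comp (by fun_prop : Continuous fun x => (x, s))
  have hyx : ∀ x, Continuous (y x) := fun x => hy.comp (by fun_prop : Continuous fun s => (x, s))
  have hytx : ∀ x, Continuous (yt x) :=
    fun x => hyt.comp (by fun_prop : Continuous fun s => (x, s))
  have hftc : ∀ x ∈ uIcc (0 : ℝ) 1,
      Real.exp (2 * α * t) * y x t ^ 2 - y x 0 ^ 2 =
        ∫ s in (0 : ℝ)..t, Real.exp (2 * α * s) *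
          (2 * α * y x s ^ 2 + 2 * y x s * yt x s) := by
    intro x hx
    rw [uIcc_of_le zero_le_one] at hx
    have hyx' := hyx x
    have hytx' := hytx x
    rw [integral_eq_sub_of_hasDerivAt_of_le
      (f := fun s => Real.exp (2 * α * s) * y x s ^ 2) ht (by fun_prop) (fun s hs => ?_)
      (Continuous.intervalIntegrable (by fun_prop) _ _)]
    · simp
    · have hexp : HasDerivAt (fun s => Real.exp (2 * α * s))
          (Real.exp (2 * α * s) * (2 * α * 1)) s :=
        ((hasDerivAt_id s).const_mul (2 * α)).exp
      refine (hexp.mul ((hderiv x hx s hs.1).pow 2)).congr_deriv ?_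
      simp
      ring
  have hyt2 := hys t
  have hy02 := hys 0
  rw [← integral_const_mul, ← integral_sub (Continuous.intervalIntegrable (by fun_prop) _ _)
    (Continuous.intervalIntegrable (by fun_prop) _ _), integral_congr hftc,
    MeasureTheory.intervalIntegral_intervalIntegral_swap]
  · refine integral_congr fun s _ => ?_
    have h1 := hys s
    have h2 := hyts s
    rw [integral_const_mul, integral_add (Continuous.intervalIntegrable (by fun_prop) _ _)
      (Continuous.intervalIntegrable (by fun_prop) _ _), integral_const_mul]
  · have hcont : Continuous (Function.uncurry fun x s => Real.exp (2 * α * s) *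
        (2 * α * y x s ^ 2 + 2 * y x s * yt x s)) := by
      simp only [Function.uncurry_def]
      fun_prop
    exact (hcont.continuousOn.integrableOn_compact (isCompact_uIcc.prod isCompact_uIcc)).mono_set
      (prod_mono uIoc_subset_uIcc uIoc_subset_uIcc)

/-- Extension of a function from `[0,1] × [0,∞)` to the plane by projecting the arguments. -/
noncomputable def stripExtend (f : ℝ → ℝ → ℝ) (x s : ℝ) : ℝ :=
  f (projIcc 0 1 zero_le_one x) (max 0 s)

lemma stripExtend_eq (f : ℝ → ℝ → ℝ) {x s : ℝ} (hx : x ∈ Icc (0 : ℝ) 1) (hs : 0 ≤ s) :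
    stripExtend f x s = f x s := by
  simp [stripExtend, projIcc_of_mem zero_le_one hx, max_eq_right hs]

lemma continuous_stripExtend {f : ℝ → ℝ → ℝ}
    (hf : ContinuousOn (fun p : ℝ × ℝ => f p.1 p.2) (Icc 0 1 ×ˢ Ici 0)) :
    Continuous fun p : ℝ × ℝ => stripExtend f p.1 p.2 := by
  refine hf.comp_continuous
    (f := fun p : ℝ × ℝ => ((projIcc 0 1 zero_le_one p.1 : ℝ), max 0 p.2)) ?_ fun p => ?_
  · exact (continuous_subtype_val.comp (continuous_projIcc.comp continuous_fst)).prodMk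
      (by fun_prop)
  · exact ⟨(projIcc 0 1 zero_le_one p.1).2, mem_Ici.2 (le_max_left _ _)⟩

lemma hasDerivAt_stripExtend_left {f : ℝ → ℝ → ℝ} {f' x s : ℝ} (hx : x ∈ Ioo (0 : ℝ) 1)
    (hs : 0 ≤ s) (hf : HasDerivAt (fun z => f z s) f' x) :
    HasDerivAt (fun z => stripExtend f z s) f' x :=
  hf.congr_of_eventuallyEq <| by
    filter_upwards [Ioo_mem_nhds hx.1 hx.2] with z hz
    exact stripExtend_eq f (Ioo_subset_Icc_self hz) hs

lemma hasDerivAt_stripExtend_right {f : ℝ → ℝ → ℝ} {f' x s : ℝ} (hx : x ∈ Icc (0 : ℝ) 1)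
    (hs : 0 < s) (hf : HasDerivAt (fun r => f x r) f' s) :
    HasDerivAt (stripExtend f x) f' s :=
  hf.congr_of_eventuallyEq <| by
    filter_upwards [Ioi_mem_nhds hs] with r hr
    exact stripExtend_eq f hx (le_of_lt hr)

lemma integral_stripExtend_pow (f : ℝ → ℝ → ℝ) (n : ℕ) {s : ℝ} (hs : 0 ≤ s) :
    ∫ x in (0 : ℝ)..1, stripExtend f x s ^ n = ∫ x in (0 : ℝ)..1, f x s ^ n :=
  integral_congr fun x hx => by
    rw [uIcc_of_le zero_le_one] at hx
    simp only [stripExtend_eq f hx hs]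

/-- `L²` stabilization with exponential decay for the controlled Chafee–Infante
equation `y_t = ν y_xx + γ y − δ y³ − μ I_h(y)` on `(0,1) × (0,∞)` with mixed
boundary conditions `y(0,t) = 0`, `y_x(1,t) = 0`, where `I_h` is the nodal-value
interpolant on a uniform mesh of size `h = 1/N`: for every `t ≥ 0`,
`∫₀¹ y(·,t)² + e^{−2αt} ∫₀ᵗ e^{2αs} [β ∫₀¹ y_x² + 2δ ∫₀¹ y⁴ + β₁ ∫₀¹ y²] ds
  ≤ e^{−2αt} ∫₀¹ y(·,0)²`. -/
theorem stmt_1 (N : ℕ) (hN : 0 < N) (h : ℝ) (hh : h = 1 / N)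
    (xstar : ℕ → ℝ)
    (hxstar : ∀ j : ℕ, 1 ≤ j → j ≤ N →
      xstar j ∈ Set.Icc (((j : ℝ) - 1) * h) ((j : ℝ) * h))
    (Ih : (ℝ → ℝ) → ℝ → ℝ)
    (hIh : ∀ (φ : ℝ → ℝ) (j : ℕ), 1 ≤ j → j ≤ N →
      ∀ x ∈ Set.Ico (((j : ℝ) - 1) * h) ((j : ℝ) * h), Ih φ x = φ (xstar j))
    (ν γ δ μ α β β₁ : ℝ)
    (hν : 0 < ν) (hγ : 0 < γ) (hδ : 0 < δ) (hμ : 0 < μ)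
    (hνh : ν ≥ μ * h ^ 2 / 2) (hμ2 : μ ≥ 2 * (γ + ν))
    (hα : 0 < α) (hα2 : α ≤ (μ - 2 * γ - 2 * ν) / 2)
    (hβ : β = 2 * ν - μ * h ^ 2) (hβ₁ : β₁ = μ - 2 * γ - 2 * ν - 2 * α)
    (y yt yx yxx : ℝ → ℝ → ℝ)
    (hycont : ContinuousOn (fun p : ℝ × ℝ => y p.1 p.2)
      (Set.Icc 0 1 ×ˢ Set.Ici 0))
    (hytcont : ContinuousOn (fun p : ℝ × ℝ => yt p.1 p.2)
      (Set.Icc 0 1 ×ˢ Set.Ici 0))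
    (hyxcont : ContinuousOn (fun p : ℝ × ℝ => yx p.1 p.2)
      (Set.Icc 0 1 ×ˢ Set.Ici 0))
    (hyxxcont : ContinuousOn (fun p : ℝ × ℝ => yxx p.1 p.2)
      (Set.Icc 0 1 ×ˢ Set.Ici 0))
    (hyt : ∀ x ∈ Set.Icc (0:ℝ) 1, ∀ t ∈ Set.Ici (0:ℝ),
      HasDerivAt (fun s => y x s) (yt x t) t)
    (hyx : ∀ x ∈ Set.Icc (0:ℝ) 1, ∀ t ∈ Set.Ici (0:ℝ),
      HasDerivAt (fun u => y u t) (yx x t) x)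
    (hyxx : ∀ x ∈ Set.Icc (0:ℝ) 1, ∀ t ∈ Set.Ici (0:ℝ),
      HasDerivAt (fun u => yx u t) (yxx x t) x)
    (hpde : ∀ x ∈ Set.Ioo (0:ℝ) 1, ∀ t ∈ Set.Ioi (0:ℝ),
      yt x t = ν * yxx x t + γ * y x t - δ * (y x t) ^ 3
        - μ * Ih (fun u => y u t) x)
    (hbc0 : ∀ t ∈ Set.Ici (0:ℝ), y 0 t = 0)
    (hbc1 : ∀ t ∈ Set.Ici (0:ℝ), yx 1 t = 0) :
    ∀ t ∈ Set.Ici (0:ℝ),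
      (∫ x in (0:ℝ)..1, (y x t) ^ 2) +
        Real.exp (-(2 * α * t)) *
          ∫ s in (0:ℝ)..t,
            Real.exp (2 * α * s) *
              (β * (∫ x in (0:ℝ)..1, (yx x s) ^ 2) +
               2 * δ * (∫ x in (0:ℝ)..1, (y x s) ^ 4) +
               β₁ * (∫ x in (0:ℝ)..1, (y x s) ^ 2))
      ≤ Real.exp (-(2 * α * t)) * ∫ x in (0:ℝ)..1, (y x 0) ^ 2 := by
  intro t ht
  have ht0 : (0 : ℝ) ≤ t := ht
  have hYc := continuous_stripExtend hycont
  have hYtc := continuous_stripExtend hytcont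
  have hYxc := continuous_stripExtend hyxcont
  have hYxxc := continuous_stripExtend hyxxcont
  have hN' : (0 : ℝ) < N := Nat.cast_pos.2 hN
  have hpos : 0 < h := by rw [hh]; positivity
  have hNh : (N : ℝ) * h = 1 := by rw [hh]; field_simp
  have hcell : ∀ j : ℕ, 1 ≤ j → j ≤ N →
      0 ≤ ((j : ℝ) - 1) * h ∧ (j : ℝ) * h ≤ 1 := by
    intro j hj hjN
    have hj' : (1 : ℝ) ≤ j := by exact_mod_cast hj
    refine ⟨mul_nonneg (by linarith) hpos.le, ?_⟩
    rw [← hNh]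
    exact mul_le_mul_of_nonneg_right (by exact_mod_cast hjN) hpos.le
  have hdiss : ∀ s, 0 < s →
      ∫ x in (0 : ℝ)..1, 2 * stripExtend y x s * stripExtend yt x s ≤
        -((2 * ν - μ * h ^ 2) * (∫ x in (0 : ℝ)..1, stripExtend yx x s ^ 2) +
          2 * δ * (∫ x in (0 : ℝ)..1, stripExtend y x s ^ 4) +
          (μ - 2 * γ) * ∫ x in (0 : ℝ)..1, stripExtend y x s ^ 2) := by
    intro s hs
    refine two_mul_integral_mul_le_dissipation hN hh hxstar (ν := ν) hμ
      (u'' := fun x => stripExtend yxx x s)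
      (hYc.comp (by fun_prop : Continuous fun x => (x, s)))
      (hYxc.comp (by fun_prop : Continuous fun x => (x, s)))
      (hYxxc.comp (by fun_prop : Continuous fun x => (x, s)))
      (hYtc.comp (by fun_prop : Continuous fun x => (x, s)))
      (fun x hx => ?_) (fun x hx => ?_) ?_ ?_ fun j hj hjN x hx => ?_
    · rw [stripExtend_eq yx (Ioo_subset_Icc_self hx) hs.le]
      exact hasDerivAt_stripExtend_left hx hs.le (hyx x (Ioo_subset_Icc_self hx) s hs.le)
    · rw [stripExtend_eq yxx (Ioo_subset_Icc_self hx) hs.le]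
      exact hasDerivAt_stripExtend_left hx hs.le (hyxx x (Ioo_subset_Icc_self hx) s hs.le)
    · rw [stripExtend_eq y (by simp) hs.le]
      exact hbc0 s hs.le
    · rw [stripExtend_eq yx (by simp) hs.le]
      exact hbc1 s hs.le
    · obtain ⟨hl, hr⟩ := hcell j hj hjN
      have hx01 : x ∈ Ioo (0 : ℝ) 1 := ⟨hl.trans_lt hx.1, hx.2.trans_le hr⟩
      have hxI := Ioo_subset_Icc_self hx01
      have hnode := hxstar j hj hjN
      rw [stripExtend_eq y hxI hs.le, stripExtend_eq yt hxI hs.le,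
        stripExtend_eq yxx hxI hs.le,
        stripExtend_eq y ⟨hl.trans hnode.1, hnode.2.trans hr⟩ hs.le, hpde x hx01 s hs,
        hIh _ j hj hjN x (Ioo_subset_Ico_self hx)]
  have henergy := exp_mul_integral_sq_sub_eq hYc hYtc
    (fun x hx s hs => by
      rw [stripExtend_eq yt hx (le_of_lt hs)]
      exact hasDerivAt_stripExtend_right hx hs (hyt x hx s (mem_Ici.2 (le_of_lt hs)))) α ht0
  have hcontInt : ∀ {F : ℝ → ℝ → ℝ}, (Continuous fun p : ℝ × ℝ => F p.1 p.2) →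
      Continuous fun s => ∫ x in (0 : ℝ)..1, F x s := fun {F} hF =>
    continuous_parametric_intervalIntegral_of_continuous' (f := fun s x => F x s)
      (hF.comp continuous_swap) 0 1
  have hc1 := hcontInt (F := fun x s => stripExtend yx x s ^ 2) (hYxc.pow 2)
  have hc2 := hcontInt (F := fun x s => stripExtend y x s ^ 4) (hYc.pow 4)
  have hc3 := hcontInt (F := fun x s => stripExtend y x s ^ 2) (hYc.pow 2)
  have hc4 := hcontInt (F := fun x s => 2 * stripExtend y x s * stripExtend yt x s)
    ((continuous_const.mul hYc).mul hYtc)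
  have hdecay :
      (∫ s in (0 : ℝ)..t, Real.exp (2 * α * s) *
        (2 * α * (∫ x in (0 : ℝ)..1, stripExtend y x s ^ 2) +
          ∫ x in (0 : ℝ)..1, 2 * stripExtend y x s * stripExtend yt x s)) ≤
      ∫ s in (0 : ℝ)..t, -(Real.exp (2 * α * s) *
        (β * (∫ x in (0 : ℝ)..1, stripExtend yx x s ^ 2) +
          2 * δ * (∫ x in (0 : ℝ)..1, stripExtend y x s ^ 4) +
          β₁ * (∫ x in (0 : ℝ)..1, stripExtend y x s ^ 2))) := by
    refine integral_mono_on_of_le_Ioo ht0 (Continuous.intervalIntegrable (by fun_prop) _ _)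
      (Continuous.intervalIntegrable (by fun_prop) _ _) fun s hs => ?_
    rw [← mul_neg]
    refine mul_le_mul_of_nonneg_left ?_ (Real.exp_pos _).le
    have hsq : 0 ≤ ∫ x in (0 : ℝ)..1, stripExtend y x s ^ 2 :=
      integral_nonneg zero_le_one fun x _ => sq_nonneg _
    rw [hβ, hβ₁]
    linarith [hdiss s hs.1, mul_nonneg hν.le hsq]
  rw [← henergy, integral_neg, integral_stripExtend_pow y 2 ht0,
    integral_stripExtend_pow y 2 le_rfl] at hdecay
  have hrewrite : (∫ s in (0 : ℝ)..t, Real.exp (2 * α * s) *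
        (β * (∫ x in (0 : ℝ)..1, stripExtend yx x s ^ 2) +
          2 * δ * (∫ x in (0 : ℝ)..1, stripExtend y x s ^ 4) +
          β₁ * (∫ x in (0 : ℝ)..1, stripExtend y x s ^ 2))) =
      ∫ s in (0 : ℝ)..t, Real.exp (2 * α * s) *
        (β * (∫ x in (0 : ℝ)..1, yx x s ^ 2) +
          2 * δ * (∫ x in (0 : ℝ)..1, y x s ^ 4) +
          β₁ * (∫ x in (0 : ℝ)..1, y x s ^ 2)) := by
    refine integral_congr fun s hs => ?_
    rw [uIcc_of_le ht0] at hs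
    simp only [integral_stripExtend_pow _ _ hs.1]
  rw [hrewrite] at hdecay
  have hexp : Real.exp (-(2 * α * t)) * Real.exp (2 * α * t) = 1 := by
    rw [← Real.exp_add]
    simp
  have hscaled := mul_le_mul_of_nonneg_left hdecay (Real.exp_pos (-(2 * α * t))).le
  rw [mul_sub, ← mul_assoc, hexp, one_mul, mul_neg] at hscaled
  linarith
end

section
/- Let N be a positive integer, h = 1/N, and for j = 1,…,N let J_j = [(j−1)h, jh] and fix points x_j* ∈ J_j; let I_h be the associated nodal-value interpolant. Let ν, γ, δ, μ be positive constants satisfying ν ≥ μh²/2 and μ ≥ 2(γ+ν), and let α satisfy 0 < α ≤ (μ − 2γ − 2ν)/2. Suppose y : [0,1] × [0,∞) → ℝ is continuous, with continuous partial derivatives y_t, y_x, y_xx and continuous mixed partial y_tx on [0,1] × [0,∞), satisfies the controlled Chafee–Infante equation y_t(x,t) = ν y_xx(x,t) + γ y(x,t) − δ y(x,t)³ − μ (I_h y(·,t))(x) for all x ∈ (0,1), t > 0, with boundary conditions y(0,t) = 0 and y_x(1,t) = 0 for all t ≥ 0. Then there exists a constant C > 0, depending only on ν, γ, δ, μ,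 α (and not on y or t), such that for every t ≥ 0: ∫₀¹ y_x(x,t)² dx ≤ C e^{−2αt} ( ∫₀¹ y(x,0)² dx + ∫₀¹ y_x(x,0)² dx ). -/
open Set MeasureTheory

section Parametric

variable {f f' : ℝ → ℝ → ℝ}

lemma continuousOn_slice
    (hf : ContinuousOn (fun p : ℝ × ℝ => f p.1 p.2) (Icc 0 1 ×ˢ Ici 0)) {t : ℝ} (ht : 0 ≤ t) :
    ContinuousOn (fun x => f x t) (Icc 0 1) :=
  hf.comp (f := fun x : ℝ => (x, t)) (by fun_prop) fun _ hx => ⟨hx, ht⟩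

/-- Integrating out the space variable of a continuous function on `[0,1] × [0,∞)` gives a
continuous function of time. -/
lemma continuousOn_integral_slice
    (hf : ContinuousOn (fun p : ℝ × ℝ => f p.1 p.2) (Icc 0 1 ×ˢ Ici 0)) :
    ContinuousOn (fun t => ∫ x in (0:ℝ)..1, f x t) (Ici 0) := by
  have hg : Continuous (Function.uncurry fun t x : ℝ => f (max 0 (min 1 x)) (max 0 t)) := by
    refine hf.comp_continuous
      (f := fun p : ℝ × ℝ => (max 0 (min 1 p.2), max 0 p.1)) (by fun_prop) fun p => ?_
    exact ⟨⟨le_max_left _ _, max_le zero_le_one (min_le_left _ _)⟩, mem_Ici.2 (le_max_left _ _)⟩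
  refine (intervalIntegral.continuous_parametric_intervalIntegral_of_continuous'
    (μ := volume) hg 0 1).continuousOn.congr fun t ht => ?_
  refine intervalIntegral.integral_congr fun x hx => ?_
  rw [uIcc_of_le zero_le_one] at hx
  simp only [min_eq_right hx.2, max_eq_right hx.1, max_eq_right (mem_Ici.1 ht)]

/-- Differentiation under the integral sign over `[0, b] ⊆ [0, 1]` at positive times. -/
lemma hasDerivAt_integral_slice
    (hf : ContinuousOn (fun p : ℝ × ℝ => f p.1 p.2) (Icc 0 1 ×ˢ Ici 0))
    (hf' : ContinuousOn (fun p : ℝ × ℝ => f' p.1 p.2) (Icc 0 1 ×ˢ Ici 0))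
    (hderiv : ∀ x ∈ Icc (0:ℝ) 1, ∀ t ∈ Ici (0:ℝ), HasDerivAt (fun s => f x s) (f' x t) t)
    {b t : ℝ} (hb : b ∈ Icc (0:ℝ) 1) (ht : 0 < t) :
    HasDerivAt (fun s => ∫ x in (0:ℝ)..b, f x s) (∫ x in (0:ℝ)..b, f' x t) t := by
  have hsub : uIoc 0 b ⊆ Icc 0 1 := by
    rw [uIoc_of_le hb.1]
    exact fun x hx => ⟨hx.1.le, hx.2.trans hb.2⟩
  have hsub' : uIcc 0 b ⊆ Icc 0 1 := by
    rw [uIcc_of_le hb.1]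
    exact Icc_subset_Icc_right hb.2
  have hmeas : ∀ {g : ℝ → ℝ → ℝ},
      ContinuousOn (fun p : ℝ × ℝ => g p.1 p.2) (Icc 0 1 ×ˢ Ici 0) → ∀ s : ℝ, 0 ≤ s →
      AEStronglyMeasurable (fun x => g x s) (volume.restrict (uIoc 0 b)) := fun hg s hs =>
    ((continuousOn_slice hg hs).mono hsub).aestronglyMeasurable measurableSet_uIoc
  obtain ⟨K, hK⟩ := (isCompact_Icc.prod (isCompact_Icc (a := 0) (b := 2 * t))
    |>.exists_bound_of_continuousOn (hf'.mono (prod_mono_right Icc_subset_Ici_self)))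
  refine (intervalIntegral.hasDerivAt_integral_of_dominated_loc_of_deriv_le
    (F := fun s x => f x s) (F' := fun s x => f' x s) (bound := fun _ => K)
    (Icc_mem_nhds ht (by linarith : t < 2 * t)) ?_ ?_ (hmeas hf' t ht.le) ?_ ?_ ?_).2
  · filter_upwards [Ioi_mem_nhds ht] with s hs using hmeas hf s (le_of_lt hs)
  · exact ((continuousOn_slice hf ht.le).mono hsub').intervalIntegrable
  · exact Filter.Eventually.of_forall fun x hx s hs => hK (x, s) ⟨hsub hx, hs⟩
  · exact intervalIntegrable_const
  · exact Filter.Eventually.of_forall fun x hx s hs => hderiv x (hsub hx) s hs.1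

end Parametric

/-- Cauchy–Schwarz for the increment of a `C¹` function. -/
lemma sq_sub_le_mul_integral_sq {u u' : ℝ → ℝ} {a b : ℝ} (hab : a ≤ b)
    (hu : ∀ x ∈ Icc a b, HasDerivAt u (u' x) x) (hu' : ContinuousOn u' (Icc a b)) :
    (u b - u a) ^ 2 ≤ (b - a) * ∫ x in a..b, u' x ^ 2 := by
  rcases hab.eq_or_lt with rfl | hlt
  · simp
  rw [← uIcc_of_le hab] at hu hu'
  set m := (u b - u a) / (b - a) with hm
  have hpos : 0 < b - a := sub_pos.2 hlt
  have hmul : u b - u a = m * (b - a) := by rw [hm]; field_simp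
  have hnn : 0 ≤ ∫ x in a..b, (u' x - m) ^ 2 :=
    intervalIntegral.integral_nonneg hab fun x _ => sq_nonneg _
  have hint : IntervalIntegrable u' volume a b := hu'.intervalIntegrable
  have hint2 : IntervalIntegrable (fun x => u' x ^ 2) volume a b := (hu'.pow 2).intervalIntegrable
  have hexp : ∫ x in a..b, (u' x - m) ^ 2
      = (∫ x in a..b, u' x ^ 2) - 2 * m * (u b - u a) + (b - a) * m ^ 2 := by
    rw [← intervalIntegral.integral_eq_sub_of_hasDerivAt hu hint,
      ← intervalIntegral.integral_const_mul, ← intervalIntegral.integral_sub hint2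
        (hint.const_mul _), ← smul_eq_mul (b - a), ← intervalIntegral.integral_const,
      ← intervalIntegral.integral_add (hint2.sub (hint.const_mul _)) intervalIntegrable_const]
    exact intervalIntegral.integral_congr fun x _ => by ring
  have hle : (b - a) * m ^ 2 ≤ ∫ x in a..b, u' x ^ 2 := by
    rw [hexp, hmul] at hnn
    nlinarith
  calc (u b - u a) ^ 2 = (b - a) * ((b - a) * m ^ 2) := by rw [hmul]; ring
    _ ≤ _ := mul_le_mul_of_nonneg_left hle hpos.le

/-- Interpolation error on one cell: the deviation of `u` from any of its values on `[a, b]`. -/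
lemma sq_sub_le_mul_integral_sq_of_mem {u u' : ℝ → ℝ} {a b x c : ℝ}
    (hu : ∀ x ∈ Icc a b, HasDerivAt u (u' x) x) (hu' : ContinuousOn u' (Icc a b))
    (hx : x ∈ Icc a b) (hc : c ∈ Icc a b) :
    (u x - u c) ^ 2 ≤ (b - a) * ∫ x in a..b, u' x ^ 2 := by
  wlog hcx : c ≤ x generalizing x c
  · rw [sub_sq_comm]
    exact this hc hx (le_of_not_ge hcx)
  have hab : a ≤ b := hx.1.trans hx.2
  have hsub : Icc c x ⊆ Icc a b := Icc_subset_Icc hc.1 hx.2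
  refine (sq_sub_le_mul_integral_sq hcx (fun z hz => hu z (hsub hz)) (hu'.mono hsub)).trans ?_
  have hmono : ∫ z in c..x, u' z ^ 2 ≤ ∫ z in a..b, u' z ^ 2 :=
    intervalIntegral.integral_mono_interval hc.1 hcx hx.2
      (Filter.Eventually.of_forall fun z => sq_nonneg _)
      ((hu'.pow 2).intervalIntegrable_of_Icc hab)
  have hnn : 0 ≤ ∫ z in c..x, u' z ^ 2 :=
    intervalIntegral.integral_nonneg hcx fun z _ => sq_nonneg _
  exact mul_le_mul (by linarith [hx.2, hc.1]) hmono hnn (by linarith)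

/-- If `e` is, on each cell of the uniform mesh of width `1 / N`, the deviation of `u` from a nodal
value, then `‖e‖² ≤ h² ‖u'‖²` in `L²(0,1)`. -/
lemma integral_sq_interpolation_error_le {u u' e : ℝ → ℝ} {N : ℕ} {h : ℝ} {xstar : ℕ → ℝ}
    (hN : 0 < N) (hh : h = 1 / N)
    (hxstar : ∀ j : ℕ, 1 ≤ j → j ≤ N → xstar j ∈ Icc (((j : ℝ) - 1) * h) ((j : ℝ) * h))
    (hu : ∀ x ∈ Icc (0:ℝ) 1, HasDerivAt u (u' x) x) (hu' : ContinuousOn u' (Icc 0 1))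
    (he : ContinuousOn e (Icc 0 1))
    (heq : ∀ j : ℕ, 1 ≤ j → j ≤ N → ∀ x ∈ Ioo (((j : ℝ) - 1) * h) ((j : ℝ) * h),
      e x = u x - u (xstar j)) :
    ∫ x in (0:ℝ)..1, e x ^ 2 ≤ h ^ 2 * ∫ x in (0:ℝ)..1, u' x ^ 2 := by
  have hN' : (0:ℝ) < N := Nat.cast_pos.2 hN
  have hpos : 0 < h := by rw [hh]; positivity
  have hNh : (N : ℝ) * h = 1 := by rw [hh]; field_simp
  let a : ℕ → ℝ := fun k => k * h
  have hcell : ∀ k < N, Icc (a k) (a (k + 1)) ⊆ Icc 0 1 := fun k hk => by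
    refine Icc_subset_Icc (by positivity) ?_
    rw [← hNh]
    exact mul_le_mul_of_nonneg_right (by exact_mod_cast hk) hpos.le
  have hle : ∀ k, a k ≤ a (k + 1) := fun k => by
    simp only [a]; push_cast; linarith
  have hsplit : ∀ g : ℝ → ℝ, ContinuousOn g (Icc 0 1) →
      ∑ k ∈ Finset.range N, ∫ x in a k..a (k + 1), g x ^ 2 = ∫ x in (0:ℝ)..1, g x ^ 2 := by
    intro g hg
    rw [intervalIntegral.sum_integral_adjacent_intervals (f := fun x => g x ^ 2) fun k hk =>
      ((hg.mono (hcell k hk)).pow 2).intervalIntegrable_of_Icc (hle k)]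
    simp only [a, Nat.cast_zero, zero_mul, hNh]
  rw [← hsplit e he, ← hsplit u' hu', Finset.mul_sum]
  refine Finset.sum_le_sum fun k hk => ?_
  have hk := Finset.mem_range.1 hk
  have hlen : a (k + 1) - a k = h := by simp only [a]; push_cast; ring
  have hleft : (((k + 1 : ℕ) : ℝ) - 1) * h = a k := by simp only [a]; push_cast; ring
  have hstar := hxstar (k + 1) (by omega) hk
  have heq := heq (k + 1) (by omega) hk
  rw [hleft] at hstar heq
  calc ∫ x in a k..a (k + 1), e x ^ 2
      ≤ ∫ x in a k..a (k + 1), h * ∫ z in a k..a (k + 1), u' z ^ 2 := by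
        refine intervalIntegral.integral_mono_on_of_le_Ioo (hle k)
          (((he.mono (hcell k hk)).pow 2).intervalIntegrable_of_Icc (hle k))
          intervalIntegrable_const fun x hx => ?_
        rw [heq x hx, ← hlen]
        exact sq_sub_le_mul_integral_sq_of_mem (fun z hz => hu z (hcell k hk hz))
          (hu'.mono (hcell k hk)) (Ioo_subset_Icc_self hx) hstar
    _ = h ^ 2 * ∫ z in a k..a (k + 1), u' z ^ 2 := by
        rw [intervalIntegral.integral_const, hlen, smul_eq_mul]; ring

/-- Testing `v = ν u'' + γ u - δ u³ - μ (u - e)` against `-u''` under the boundary conditions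
`u(0) = v(0) = 0`, `u'(1) = 0`. -/
lemma integral_deriv_mul_deriv_le {ν γ δ μ : ℝ} (hν : 0 < ν) (hδ : 0 < δ)
    {u u' u'' v v' e : ℝ → ℝ}
    (hu : ∀ x ∈ Icc (0:ℝ) 1, HasDerivAt u (u' x) x)
    (hu' : ∀ x ∈ Icc (0:ℝ) 1, HasDerivAt u' (u'' x) x)
    (hv : ∀ x ∈ Ioo (0:ℝ) 1, HasDerivAt v (v' x) x)
    (hu''c : ContinuousOn u'' (Icc 0 1)) (hvc : ContinuousOn v (Icc 0 1))
    (hv'c : ContinuousOn v' (Icc 0 1)) (hec : ContinuousOn e (Icc 0 1))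
    (heq : ∀ x ∈ Icc (0:ℝ) 1, v x = ν * u'' x + γ * u x - δ * u x ^ 3 - μ * (u x - e x))
    (hu0 : u 0 = 0) (hv0 : v 0 = 0) (hu1 : u' 1 = 0) :
    ∫ x in (0:ℝ)..1, u' x * v' x
      ≤ (γ - μ) * (∫ x in (0:ℝ)..1, u' x ^ 2) + μ ^ 2 / (4 * ν) * ∫ x in (0:ℝ)..1, e x ^ 2 := by
  have huc : ContinuousOn u (Icc 0 1) := HasDerivAt.continuousOn hu
  have hu'c : ContinuousOn u' (Icc 0 1) := HasDerivAt.continuousOn hu'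
  have hii : ∀ {g : ℝ → ℝ}, ContinuousOn g (Icc 0 1) → IntervalIntegrable g volume 0 1 :=
    fun hg => hg.intervalIntegrable_of_Icc zero_le_one
  let Φ : ℝ → ℝ := fun x => u' x * v x - (γ - μ) * (u x * u' x) + δ * (u x ^ 3 * u' x)
  let Φ' : ℝ → ℝ := fun x => u'' x * v x + u' x * v' x
    - (γ - μ) * (u' x * u' x + u x * u'' x)
    + δ * (3 * u x ^ 2 * u' x * u' x + u x ^ 3 * u'' x)
  have hΦ' : ContinuousOn Φ' (Icc 0 1) := by fun_prop
  have hΦ : ∫ x in (0:ℝ)..1, Φ' x = 0 := by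
    rw [intervalIntegral.integral_eq_sub_of_hasDerivAt_of_le zero_le_one (f := Φ)
      (by fun_prop) (fun x hx => ?_) (hii hΦ')]
    · simp [Φ, hu0, hv0, hu1]
    · have hx' := Ioo_subset_Icc_self hx
      convert! (((hu' x hx').mul (hv x hx)).sub
        (((hu x hx').mul (hu' x hx')).const_mul (γ - μ))).add
        ((((hu x hx').pow 3).mul (hu' x hx')).const_mul δ) using 1
  have hsub : ∫ x in (0:ℝ)..1, u' x * v' x = ∫ x in (0:ℝ)..1, (u' x * v' x - Φ' x) := by
    rw [intervalIntegral.integral_sub (hii (by fun_prop)) (hii hΦ'), hΦ, sub_zero]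
  rw [hsub, ← intervalIntegral.integral_const_mul, ← intervalIntegral.integral_const_mul,
    ← intervalIntegral.integral_add (hii (by fun_prop)) (hii (by fun_prop))]
  refine intervalIntegral.integral_mono_on zero_le_one (hii (by fun_prop)) (hii (by fun_prop))
    fun x hx => ?_
  have hyoung : -(ν * u'' x ^ 2) - μ * u'' x * e x ≤ μ ^ 2 / (4 * ν) * e x ^ 2 := by
    have hsq : μ ^ 2 / (4 * ν) * e x ^ 2 - (-(ν * u'' x ^ 2) - μ * u'' x * e x)
        = (2 * ν * u'' x + μ * e x) ^ 2 / (4 * ν) := by field_simp; ring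
    have hnn : 0 ≤ (2 * ν * u'' x + μ * e x) ^ 2 / (4 * ν) := by positivity
    linarith
  have hcube : 0 ≤ 3 * δ * (u x * u' x) ^ 2 := by positivity
  simp only [Φ', heq x hx]
  linarith

/-- A time-independent boundary value `y(0, ·) = 0` makes `y_t(·, t)` a primitive of `y_{tx}`. -/
lemma eq_integral_mixed_partial {y yt yx ytx : ℝ → ℝ → ℝ}
    (hyx : ContinuousOn (fun p : ℝ × ℝ => yx p.1 p.2) (Icc 0 1 ×ˢ Ici 0))
    (hytx : ContinuousOn (fun p : ℝ × ℝ => ytx p.1 p.2) (Icc 0 1 ×ˢ Ici 0))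
    (dyt : ∀ x ∈ Icc (0:ℝ) 1, ∀ t ∈ Ici (0:ℝ), HasDerivAt (fun s => y x s) (yt x t) t)
    (dyx : ∀ x ∈ Icc (0:ℝ) 1, ∀ t ∈ Ici (0:ℝ), HasDerivAt (fun u => y u t) (yx x t) x)
    (dytx : ∀ x ∈ Icc (0:ℝ) 1, ∀ t ∈ Ici (0:ℝ), HasDerivAt (fun s => yx x s) (ytx x t) t)
    (hy0 : ∀ t ∈ Ici (0:ℝ), y 0 t = 0) {x t : ℝ} (hx : x ∈ Icc (0:ℝ) 1) (ht : 0 < t) :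
    yt x t = ∫ z in (0:ℝ)..x, ytx z t := by
  refine (dyt x hx t ht.le).unique
    ((hasDerivAt_integral_slice hyx hytx dytx hx ht).congr_of_eventuallyEq ?_)
  filter_upwards [Ioi_mem_nhds ht] with s hs
  have hs : 0 ≤ s := le_of_lt hs
  have hsub : uIcc 0 x ⊆ Icc 0 1 := by
    rw [uIcc_of_le hx.1]
    exact Icc_subset_Icc_right hx.2
  rw [intervalIntegral.integral_eq_sub_of_hasDerivAt (fun z hz => dyx z (hsub hz) s hs)
    ((continuousOn_slice hyx hs).mono hsub).intervalIntegrable, hy0 s hs, sub_zero]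

lemma hasDerivAt_of_eq_integral {v w : ℝ → ℝ} (hw : ContinuousOn w (Icc 0 1))
    (hv : ∀ x ∈ Icc (0:ℝ) 1, v x = ∫ z in (0:ℝ)..x, w z) {x : ℝ} (hx : x ∈ Ioo (0:ℝ) 1) :
    HasDerivAt v (w x) x := by
  have hnhds : Icc (0:ℝ) 1 ∈ nhds x := Icc_mem_nhds hx.1 hx.2
  refine (intervalIntegral.integral_hasDerivAt_right
    ((hw.mono (Icc_subset_Icc_right hx.2.le)).intervalIntegrable_of_Icc hx.1.le)
    ⟨_, hnhds, hw.aestronglyMeasurable measurableSet_Icc⟩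
    (hw.continuousAt hnhds)).congr_of_eventuallyEq ?_
  filter_upwards [hnhds] with z hz using hv z hz

/-- Gronwall's inequality for `Y' ≤ -c Y` on `(0, ∞)`. -/
lemma le_exp_mul_of_deriv_le {Y Y' : ℝ → ℝ} {c : ℝ} (hY : ContinuousOn Y (Ici 0))
    (hd : ∀ t, 0 < t → HasDerivAt Y (Y' t) t) (hle : ∀ t, 0 < t → Y' t ≤ -c * Y t)
    {t : ℝ} (ht : 0 ≤ t) : Y t ≤ Real.exp (-(c * t)) * Y 0 := by
  have hZ : ∀ s, 0 < s → HasDerivAt (fun s => Real.exp (c * s) * Y s)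
      (Real.exp (c * s) * (c * Y s + Y' s)) s := fun s hs => by
    convert! (((hasDerivAt_id s).const_mul c).exp).mul (hd s hs) using 1
    simp only [id, mul_one]
    ring
  have hanti : AntitoneOn (fun s => Real.exp (c * s) * Y s) (Ici 0) := by
    refine antitoneOn_of_deriv_nonpos (convex_Ici 0) (by fun_prop) ?_ ?_ <;>
      rw [interior_Ici] <;> intro s hs
    · exact (hZ s hs).differentiableAt.differentiableWithinAt
    · rw [(hZ s hs).deriv]
      exact mul_nonpos_of_nonneg_of_nonpos (Real.exp_pos _).le (by linarith [hle s hs])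
  have hfin := hanti self_mem_Ici ht ht
  simp only [mul_zero, Real.exp_zero, one_mul] at hfin
  rw [Real.exp_neg, ← div_eq_inv_mul, le_div_iff₀ (Real.exp_pos _)]
  linarith

/-- `H¹` stabilization with exponential decay for the controlled Chafee–Infante
equation `y_t = ν y_xx + γ y − δ y³ − μ I_h(y)` on `(0,1) × (0,∞)` with mixed
boundary conditions: there is a constant `C > 0` depending only on
`ν, γ, δ, μ, α` (not on the mesh, the solution, or `t`) such that
`∫₀¹ y_x(·,t)² ≤ C e^{−2αt} (∫₀¹ y(·,0)² + ∫₀¹ y_x(·,0)²)` for all `t ≥ 0`. -/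
theorem stmt_2 (ν γ δ μ α : ℝ)
    (hν : 0 < ν) (hγ : 0 < γ) (hδ : 0 < δ) (hμ : 0 < μ)
    (hμ2 : μ ≥ 2 * (γ + ν)) (hα : 0 < α) (hα2 : α ≤ (μ - 2 * γ - 2 * ν) / 2) :
    ∃ C > 0,
      ∀ (N : ℕ), 0 < N → ∀ h : ℝ, h = 1 / N →
      ∀ xstar : ℕ → ℝ,
      (∀ j : ℕ, 1 ≤ j → j ≤ N →
        xstar j ∈ Set.Icc (((j : ℝ) - 1) * h) ((j : ℝ) * h)) →
      ∀ Ih : (ℝ → ℝ) → ℝ → ℝ,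
      (∀ (φ : ℝ → ℝ) (j : ℕ), 1 ≤ j → j ≤ N →
        ∀ x ∈ Set.Ico (((j : ℝ) - 1) * h) ((j : ℝ) * h), Ih φ x = φ (xstar j)) →
      ν ≥ μ * h ^ 2 / 2 →
      ∀ y yt yx yxx ytx : ℝ → ℝ → ℝ,
      ContinuousOn (fun p : ℝ × ℝ => y p.1 p.2) (Set.Icc 0 1 ×ˢ Set.Ici 0) →
      ContinuousOn (fun p : ℝ × ℝ => yt p.1 p.2) (Set.Icc 0 1 ×ˢ Set.Ici 0) →
      ContinuousOn (fun p : ℝ × ℝ => yx p.1 p.2) (Set.Icc 0 1 ×ˢ Set.Ici 0) →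
      ContinuousOn (fun p : ℝ × ℝ => yxx p.1 p.2) (Set.Icc 0 1 ×ˢ Set.Ici 0) →
      ContinuousOn (fun p : ℝ × ℝ => ytx p.1 p.2) (Set.Icc 0 1 ×ˢ Set.Ici 0) →
      (∀ x ∈ Set.Icc (0:ℝ) 1, ∀ t ∈ Set.Ici (0:ℝ),
        HasDerivAt (fun s => y x s) (yt x t) t) →
      (∀ x ∈ Set.Icc (0:ℝ) 1, ∀ t ∈ Set.Ici (0:ℝ),
        HasDerivAt (fun u => y u t) (yx x t) x) →
      (∀ x ∈ Set.Icc (0:ℝ) 1, ∀ t ∈ Set.Ici (0:ℝ),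
        HasDerivAt (fun u => yx u t) (yxx x t) x) →
      (∀ x ∈ Set.Icc (0:ℝ) 1, ∀ t ∈ Set.Ici (0:ℝ),
        HasDerivAt (fun s => yx x s) (ytx x t) t) →
      (∀ x ∈ Set.Ioo (0:ℝ) 1, ∀ t ∈ Set.Ioi (0:ℝ),
        yt x t = ν * yxx x t + γ * y x t - δ * (y x t) ^ 3
          - μ * Ih (fun u => y u t) x) →
      (∀ t ∈ Set.Ici (0:ℝ), y 0 t = 0) →
      (∀ t ∈ Set.Ici (0:ℝ), yx 1 t = 0) →
      ∀ t ∈ Set.Ici (0:ℝ),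
        (∫ x in (0:ℝ)..1, (yx x t) ^ 2)
          ≤ C * Real.exp (-(2 * α * t)) *
              ((∫ x in (0:ℝ)..1, (y x 0) ^ 2) + ∫ x in (0:ℝ)..1, (yx x 0) ^ 2) := by
  refine ⟨1, one_pos, ?_⟩
  intro N hN h hh xstar hxstar Ih hIh hνh y yt yx yxx ytx cy cyt cyx cyxx cytx dyt dyx dyxx dytx
    hpde hy0 hyx1 t ht
  have hdecay : ∀ s, 0 < s → ∫ x in (0:ℝ)..1, 2 * yx x s * ytx x s
      ≤ -(2 * α) * ∫ x in (0:ℝ)..1, yx x s ^ 2 := by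
    intro s hs
    have hs0 : (0:ℝ) ≤ s := hs.le
    have hytint : ∀ x ∈ Icc (0:ℝ) 1, yt x s = ∫ z in (0:ℝ)..x, ytx z s := fun x hx =>
      eq_integral_mixed_partial cyx cytx dyt dyx dytx hy0 hx hs
    let e : ℝ → ℝ := fun x =>
      y x s - (ν * yxx x s + γ * y x s - δ * y x s ^ 3 - yt x s) / μ
    have sy := continuousOn_slice cy hs0
    have syt := continuousOn_slice cyt hs0
    have syxx := continuousOn_slice cyxx hs0
    have sytx := continuousOn_slice cytx hs0
    have syx := continuousOn_slice cyx hs0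
    have hec : ContinuousOn e (Icc 0 1) := by fun_prop
    have hpos : 0 < h := by rw [hh]; positivity
    have hNh : (N : ℝ) * h = 1 := by rw [hh]; field_simp
    have herr := integral_sq_interpolation_error_le hN hh hxstar
      (fun x hx => dyx x hx s hs0) syx hec fun j hj hjN x hx => by
        have hj' : (1:ℝ) ≤ j := by exact_mod_cast hj
        have hjN' : (j:ℝ) ≤ N := by exact_mod_cast hjN
        have hx01 : x ∈ Ioo (0:ℝ) 1 :=
          ⟨lt_of_le_of_lt (mul_nonneg (by linarith) hpos.le) hx.1,
            hx.2.trans_le (hNh ▸ mul_le_mul_of_nonneg_right hjN' hpos.le)⟩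
        have hnode := hpde x hx01 s hs
        rw [hIh _ j hj hjN x ⟨hx.1.le, hx.2⟩] at hnode
        simp only [e, hnode]
        field_simp
        ring
    have henergy := integral_deriv_mul_deriv_le (γ := γ) (μ := μ) hν hδ (e := e)
      (fun x hx => dyx x hx s hs0) (fun x hx => dyxx x hx s hs0)
      (fun x hx => hasDerivAt_of_eq_integral sytx hytint hx) syxx syt sytx hec
      (fun x _ => by simp only [e]; field_simp; ring) (hy0 s hs0)
      (by simp [hytint 0 (left_mem_Icc.2 zero_le_one)]) (hyx1 s hs0)
    have hY : 0 ≤ ∫ x in (0:ℝ)..1, yx x s ^ 2 :=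
      intervalIntegral.integral_nonneg zero_le_one fun x _ => sq_nonneg _
    have hcoef : μ ^ 2 / (4 * ν) * h ^ 2 ≤ μ / 2 := by
      rw [div_mul_eq_mul_div, div_le_iff₀ (by positivity)]
      nlinarith
    have hbound : μ ^ 2 / (4 * ν) * ∫ x in (0:ℝ)..1, e x ^ 2
        ≤ μ / 2 * ∫ x in (0:ℝ)..1, yx x s ^ 2 :=
      calc _ ≤ μ ^ 2 / (4 * ν) * (h ^ 2 * ∫ x in (0:ℝ)..1, yx x s ^ 2) :=
            mul_le_mul_of_nonneg_left herr (by positivity)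
        _ ≤ _ := by rw [← mul_assoc]; exact mul_le_mul_of_nonneg_right hcoef hY
    have hrate : (γ - μ + μ / 2 + α) * ∫ x in (0:ℝ)..1, yx x s ^ 2 ≤ 0 :=
      mul_nonpos_of_nonpos_of_nonneg (by linarith) hY
    simp only [mul_assoc, intervalIntegral.integral_const_mul]
    linarith
  have hgronwall := le_exp_mul_of_deriv_le (continuousOn_integral_slice (cyx.pow 2))
    (fun s hs => hasDerivAt_integral_slice (f' := fun x s => 2 * yx x s * ytx x s) (cyx.pow 2)
      (by fun_prop) (fun x hx s hs => by simpa using (dytx x hx s hs).fun_pow 2)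
      (right_mem_Icc.2 zero_le_one) hs) hdecay ht
  rw [one_mul]
  refine hgronwall.trans (mul_le_mul_of_nonneg_left ?_ (Real.exp_pos _).le)
  exact le_add_of_nonneg_left
    (intervalIntegral.integral_nonneg zero_le_one fun x _ => sq_nonneg _)
end

section
/- Let N be a positive integer, h = 1/N, and for j = 1,…,N let J_j = [(j−1)h, jh] and fix points x_j* ∈ J_j; let I_h be the associated nodal-value interpolant. Then for every continuously differentiable function φ : [0,1] → ℝ, ∫₀¹ (φ(x) − (I_h φ)(x))² dx ≤ h² ∫₀¹ φ'(x)² dx; in particular ∫₀¹ (φ − I_h φ)² dx ≤ h² ( ∫₀¹ φ² dx + ∫₀¹ φ'² dx ), i.e. the interpolation estimate ‖φ − I_h φ‖_{L²} ≤ h ‖φ‖_{H¹} holds with constant c_p = 1. -/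
open MeasureTheory Set

/-- Cauchy–Schwarz inequality on an interval, against the constant function `1`. -/
lemma sq_integral_le_sub_mul_integral_sq {g : ℝ → ℝ} {a b : ℝ} (hab : a ≤ b)
    (hg : ContinuousOn g (Icc a b)) :
    (∫ x in a..b, g x) ^ 2 ≤ (b - a) * ∫ x in a..b, g x ^ 2 := by
  rcases hab.eq_or_lt with rfl | hlt
  · simp
  have hg1 : IntervalIntegrable g volume a b := hg.intervalIntegrable_of_Icc hab
  have hg2 : IntervalIntegrable (fun x => g x ^ 2) volume a b :=
    (hg.pow 2).intervalIntegrable_of_Icc hab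
  set m := ∫ x in a..b, g x with hm
  have hnonneg : 0 ≤ ∫ x in a..b, ((b - a) * g x - m) ^ 2 :=
    intervalIntegral.integral_nonneg hab fun x _ => sq_nonneg _
  have hexpand : ∫ x in a..b, ((b - a) * g x - m) ^ 2
      = (b - a) ^ 2 * (∫ x in a..b, g x ^ 2) - 2 * (b - a) * m * m + (b - a) * m ^ 2 := by
    have hpoint : (fun x => ((b - a) * g x - m) ^ 2)
        = fun x => (b - a) ^ 2 * g x ^ 2 - 2 * (b - a) * m * g x + m ^ 2 := by
      funext x; ring
    rw [hpoint, intervalIntegral.integral_add ((hg2.const_mul _).sub (hg1.const_mul _))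
        intervalIntegrable_const,
      intervalIntegral.integral_sub (hg2.const_mul _) (hg1.const_mul _),
      intervalIntegral.integral_const_mul, intervalIntegral.integral_const_mul,
      intervalIntegral.integral_const, ← hm, smul_eq_mul]
  rw [hexpand] at hnonneg
  have hfactor : 0 ≤ (b - a) * ((b - a) * (∫ x in a..b, g x ^ 2) - m ^ 2) := by
    linarith
  exact sub_nonneg.1 (nonneg_of_mul_nonneg_right hfactor (sub_pos.2 hlt))

/-- Two values of a `C¹` function on `[a, b]` differ by at most `√(b - a)` times the
`L²`-norm of its derivative. -/
lemma sq_sub_le_sub_mul_integral_sq_deriv {f f' : ℝ → ℝ} {a b : ℝ}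
    (hf : ∀ x ∈ Icc a b, HasDerivAt f (f' x) x) (hf' : ContinuousOn f' (Icc a b))
    {p x : ℝ} (hp : p ∈ Icc a b) (hx : x ∈ Icc a b) :
    (f x - f p) ^ 2 ≤ (b - a) * ∫ t in a..b, f' t ^ 2 := by
  wlog hpx : p ≤ x generalizing p x
  · rw [← neg_sub, neg_sq]
    exact this hx hp (le_of_not_ge hpx)
  have hab : a ≤ b := hp.1.trans hp.2
  have hsub : Icc p x ⊆ Icc a b := Icc_subset_Icc hp.1 hx.2
  have hftc : ∫ t in p..x, f' t = f x - f p :=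
    intervalIntegral.integral_eq_sub_of_hasDerivAt
      (fun t ht => hf t (hsub (by rwa [uIcc_of_le hpx] at ht)))
      ((hf'.mono hsub).intervalIntegrable_of_Icc hpx)
  rw [← hftc]
  refine (sq_integral_le_sub_mul_integral_sq hpx (hf'.mono hsub)).trans ?_
  refine mul_le_mul (by linarith [hp.1, hx.2]) ?_
    (intervalIntegral.integral_nonneg hpx fun t _ => sq_nonneg _) (sub_nonneg.2 hab)
  exact intervalIntegral.integral_mono_interval hp.1 hpx hx.2 (ae_of_all _ fun t => sq_nonneg _)
    ((hf'.pow 2).intervalIntegrable_of_Icc hab)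

/-- The squared difference of a continuous function on `[a, b]` and a function which is
constant on `[a, b)` is integrable. -/
lemma intervalIntegrable_sq_sub_of_eq_const {f u : ℝ → ℝ} {a b c : ℝ} (hab : a ≤ b)
    (hf : ContinuousOn f (Icc a b)) (hu : ∀ x ∈ Ico a b, u x = c) :
    IntervalIntegrable (fun x => (f x - u x) ^ 2) volume a b := by
  have hcont : IntervalIntegrable (fun x => (f x - c) ^ 2) volume a b :=
    ((hf.sub continuousOn_const).pow 2).intervalIntegrable_of_Icc hab
  rw [intervalIntegrable_iff_integrableOn_Ico_of_le hab] at hcont ⊢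
  exact hcont.congr_fun (fun x hx => by simp only [hu x hx]) measurableSet_Ico

/-- Local form of the interpolation estimate, on a single cell. -/
lemma integral_sq_sub_le_of_eq_nodal_value {f f' u : ℝ → ℝ} {a b p : ℝ}
    (hf : ∀ x ∈ Icc a b, HasDerivAt f (f' x) x) (hf' : ContinuousOn f' (Icc a b))
    (hp : p ∈ Icc a b) (hu : ∀ x ∈ Ico a b, u x = f p) :
    ∫ x in a..b, (f x - u x) ^ 2 ≤ (b - a) ^ 2 * ∫ x in a..b, f' x ^ 2 := by
  have hab : a ≤ b := hp.1.trans hp.2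
  have hcont : ContinuousOn f (Icc a b) := fun x hx => (hf x hx).continuousAt.continuousWithinAt
  calc ∫ x in a..b, (f x - u x) ^ 2
      ≤ ∫ _ in a..b, (b - a) * ∫ t in a..b, f' t ^ 2 := by
        refine intervalIntegral.integral_mono_on_of_le_Ioo hab
          (intervalIntegrable_sq_sub_of_eq_const hab hcont hu) intervalIntegrable_const ?_
        intro x hx
        rw [hu x (Ioo_subset_Ico_self hx)]
        exact sq_sub_le_sub_mul_integral_sq_deriv hf hf' hp (Ioo_subset_Icc_self hx)
    _ = (b - a) ^ 2 * ∫ x in a..b, f' x ^ 2 := by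
        rw [intervalIntegral.integral_const, smul_eq_mul]; ring

/-- Nodal-value interpolation estimate: with `h = 1/N`, nodes `x_j* ∈ J_j = [(j−1)h, jh]`
and the piecewise constant interpolant `I_h φ = φ(x_j*)` on `J_j`, every continuously
differentiable `φ : [0,1] → ℝ` satisfies `∫₀¹ (φ − I_h φ)² ≤ h² ∫₀¹ φ'²`, and in
particular `‖φ − I_h φ‖_{L²} ≤ h ‖φ‖_{H¹}` with constant `c_p = 1`. -/
theorem stmt_3 (N : ℕ) (hN : 0 < N) (h : ℝ) (hh : h = 1 / N)
    (xstar : ℕ → ℝ)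
    (hxstar : ∀ j : ℕ, 1 ≤ j → j ≤ N →
      xstar j ∈ Set.Icc (((j : ℝ) - 1) * h) ((j : ℝ) * h))
    (Ih : (ℝ → ℝ) → ℝ → ℝ)
    (hIh : ∀ (φ : ℝ → ℝ) (j : ℕ), 1 ≤ j → j ≤ N →
      ∀ x ∈ Set.Ico (((j : ℝ) - 1) * h) ((j : ℝ) * h), Ih φ x = φ (xstar j)) :
    ∀ φ φ' : ℝ → ℝ,
      (∀ x ∈ Set.Icc (0:ℝ) 1, HasDerivAt φ (φ' x) x) →
      ContinuousOn φ' (Set.Icc 0 1) →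
      (∫ x in (0:ℝ)..1, (φ x - Ih φ x) ^ 2) ≤ h ^ 2 * ∫ x in (0:ℝ)..1, φ' x ^ 2 ∧
      (∫ x in (0:ℝ)..1, (φ x - Ih φ x) ^ 2)
        ≤ h ^ 2 * ((∫ x in (0:ℝ)..1, φ x ^ 2) + ∫ x in (0:ℝ)..1, φ' x ^ 2) := by
  intro φ φ' hφ hφ'
  have hN' : (0 : ℝ) < N := Nat.cast_pos.2 hN
  have hpos : 0 < h := hh ▸ one_div_pos.2 hN'
  have hNh : (N : ℝ) * h = 1 := by rw [hh]; field_simp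
  have hsub : ∀ k < N, Icc ((k : ℝ) * h) (((k + 1 : ℕ) : ℝ) * h) ⊆ Icc 0 1 := fun k hk =>
    Icc_subset_Icc (by positivity)
      (hNh ▸ mul_le_mul_of_nonneg_right (Nat.cast_le.2 hk) hpos.le)
  have hle : ∀ k : ℕ, (k : ℝ) * h ≤ ((k + 1 : ℕ) : ℝ) * h := fun k =>
    mul_le_mul_of_nonneg_right (Nat.cast_le.2 k.le_succ) hpos.le
  have hlen : ∀ k : ℕ, ((k + 1 : ℕ) : ℝ) * h - k * h = h := fun k => by push_cast; ring
  have hleft : ∀ k : ℕ, (((k + 1 : ℕ) : ℝ) - 1) * h = k * h := fun k => by push_cast; ring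
  have hnode : ∀ k < N, xstar (k + 1) ∈ Icc ((k : ℝ) * h) (((k + 1 : ℕ) : ℝ) * h) :=
    fun k hk => hleft k ▸ hxstar (k + 1) k.succ_pos hk
  have hval : ∀ k < N, ∀ x ∈ Ico ((k : ℝ) * h) (((k + 1 : ℕ) : ℝ) * h),
      Ih φ x = φ (xstar (k + 1)) :=
    fun k hk => hleft k ▸ hIh φ (k + 1) k.succ_pos hk
  have hcont : ContinuousOn φ (Icc 0 1) := fun x hx =>
    (hφ x hx).continuousAt.continuousWithinAt
  have hsplit : ∀ g : ℝ → ℝ,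
      (∀ k < N, IntervalIntegrable g volume ((k : ℝ) * h) (((k + 1 : ℕ) : ℝ) * h)) →
      ∑ k ∈ Finset.range N, ∫ x in ((k : ℝ) * h)..(((k + 1 : ℕ) : ℝ) * h), g x
        = ∫ x in (0 : ℝ)..1, g x := fun g hg => by
    have hsum := intervalIntegral.sum_integral_adjacent_intervals (a := fun k : ℕ => (k : ℝ) * h) hg
    simpa only [Nat.cast_zero, zero_mul, hNh] using hsum
  have hmain : ∫ x in (0 : ℝ)..1, (φ x - Ih φ x) ^ 2 ≤ h ^ 2 * ∫ x in (0 : ℝ)..1, φ' x ^ 2 := by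
    rw [← hsplit _ fun k hk => intervalIntegrable_sq_sub_of_eq_const (hle k)
        (hcont.mono (hsub k hk)) (hval k hk),
      ← hsplit (fun x => φ' x ^ 2) fun k hk =>
        ((hφ'.mono (hsub k hk)).pow 2).intervalIntegrable_of_Icc (hle k),
      Finset.mul_sum]
    refine Finset.sum_le_sum fun k hk => ?_
    have hkN := Finset.mem_range.1 hk
    have hcell := integral_sq_sub_le_of_eq_nodal_value (fun x hx => hφ x (hsub k hkN hx))
      (hφ'.mono (hsub k hkN)) (hnode k hkN) (hval k hkN)
    rwa [hlen] at hcell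
  refine ⟨hmain, hmain.trans (mul_le_mul_of_nonneg_left ?_ (sq_nonneg h))⟩
  exact le_add_of_nonneg_left (intervalIntegral.integral_nonneg zero_le_one fun x _ => sq_nonneg _)
end

section
/- Let X be a finite-dimensional real inner product space, let f : X → X be continuous, and suppose there exists r > 0 such that ⟨f(v), v⟩ ≥ 0 for every v ∈ X with ‖v‖ = r. Then there exists v₁ ∈ X with f(v₁) = 0 and ‖v₁‖ ≤ r. -/
open scoped RealInnerProductSpace

section

variable {X : Type*} [NormedAddCommGroup X]

theorem ContinuousLinearMap.det_one_add_pos_of_norm_lt_one [NormedSpace ℝ X]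
    [FiniteDimensional ℝ X] {A : X →L[ℝ] X} (hA : ‖A‖ < 1) : 0 < (1 + A).det := by
  have det_ne_zero : ∀ s ∈ Set.Icc (0 : ℝ) 1, (1 + s • A).det ≠ 0 := by
    intro s hs h0
    obtain ⟨v, hv, hv0⟩ := (Submodule.ne_bot_iff _).1
      (LinearMap.bot_lt_ker_of_det_eq_zero (f := ((1 + s • A : X →L[ℝ] X) : X →ₗ[ℝ] X)) h0).ne'
    have hv : v + s • A v = 0 := by simpa using hv
    have hle : ‖v‖ ≤ ‖A‖ * ‖v‖ := by
      calc ‖v‖ = ‖s • A v‖ := by rw [← norm_neg v, neg_eq_of_add_eq_zero_right hv]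
        _ ≤ 1 * ‖A v‖ := by
          rw [norm_smul, Real.norm_of_nonneg hs.1]
          gcongr
          exact hs.2
        _ ≤ ‖A‖ * ‖v‖ := by simpa using A.le_opNorm v
    nlinarith [norm_pos_iff.2 hv0]
  by_contra! hneg
  have hcont : ContinuousOn (fun s : ℝ => (1 + s • A).det) (Set.Icc 0 1) :=
    (ContinuousLinearMap.continuous_det.comp (by fun_prop)).continuousOn
  obtain ⟨s, hs, hs0⟩ := intermediate_value_Icc' zero_le_one hcont
    (show (0 : ℝ) ∈ _ by simpa [ContinuousLinearMap.det] using hneg)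
  exact det_ne_zero s hs hs0

theorem LinearMap.det_one_add_eq_sum_lagrange_basis {𝕜 V ι : Type*} [Field 𝕜] [AddCommGroup V]
    [Module 𝕜 V] [FiniteDimensional 𝕜 V] [DecidableEq ι] {s : Finset ι} {t : ι → 𝕜}
    (ht : Set.InjOn t s) (hs : Module.finrank 𝕜 V < s.card) (A : V →ₗ[𝕜] V) :
    LinearMap.det (1 + A) =
      ∑ i ∈ s, LinearMap.det (1 + t i • A) * (Lagrange.basis s t i).eval 1 := by
  let b := Module.finBasis 𝕜 V
  let M := LinearMap.toMatrix b b A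
  let p : Polynomial 𝕜 :=
    ((Polynomial.X : Polynomial 𝕜) • M.map Polynomial.C + (1 : Matrix _ _ 𝕜).map Polynomial.C).det
  have eval_p : ∀ c, p.eval c = LinearMap.det (1 + c • A) := by
    intro c
    rw [← LinearMap.det_toMatrix b, map_add, map_smul, LinearMap.toMatrix_one,
      ← Polynomial.coe_evalRingHom, RingHom.map_det]
    congr 1
    ext i j
    simp only [RingHom.mapMatrix_apply, Matrix.map_apply, Matrix.add_apply, Matrix.smul_apply,
      smul_eq_mul, Polynomial.coe_evalRingHom, Polynomial.eval_add, Polynomial.eval_mul,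
      Polynomial.eval_X, Polynomial.eval_C]
    exact add_comm _ _
  have hdeg : p.degree < s.card := by
    refine (Polynomial.degree_le_natDegree).trans_lt ?_
    have := Polynomial.natDegree_det_X_add_C_le M 1
    rw [Fintype.card_fin] at this
    exact_mod_cast this.trans_lt hs
  have := congrArg (Polynomial.eval 1) (Lagrange.eq_interpolate ht hdeg)
  simpa [Lagrange.interpolate_apply, Polynomial.eval_finsetSum, eval_p] using this

theorem LipschitzWith.injective_id_add_smul [NormedSpace ℝ X] {g : X → X} {K : NNReal}
    (hg : LipschitzWith K g) {t : ℝ} (ht : 0 ≤ t) (htK : t * K < 1) :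
    Function.Injective fun x => x + t • g x := by
  intro x y hxy
  have hle : ‖x - y‖ ≤ t * (K * ‖x - y‖) := by
    calc ‖x - y‖ = ‖t • (g y - g x)‖ := by
          congr 1
          rw [smul_sub, sub_eq_sub_iff_add_eq_add, add_comm (t • g y)]
          exact hxy
      _ = t * ‖g x - g y‖ := by rw [norm_smul, Real.norm_of_nonneg ht, norm_sub_rev]
      _ ≤ _ := by gcongr; exact hg.norm_sub_le x y
  by_contra hne
  nlinarith [norm_pos_iff.2 (sub_ne_zero.2 hne)]

theorem LipschitzWith.surjective_id_add_smul [NormedSpace ℝ X] [CompleteSpace X] {g : X → X}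
    {K : NNReal} (hg : LipschitzWith K g) {t : ℝ} (ht : 0 ≤ t) (htK : t * K < 1) :
    Function.Surjective fun x => x + t • g x := by
  intro y
  have hc : ContractingWith (t.toNNReal * K) fun x => y - t • g x := by
    refine ⟨?_, LipschitzWith.of_dist_le_mul fun a b => ?_⟩
    · rw [← NNReal.coe_lt_coe]
      simpa [ht] using htK
    · rw [dist_sub_left, dist_smul₀, Real.norm_of_nonneg ht]
      simp only [NNReal.coe_mul, Real.coe_toNNReal t ht, mul_assoc]
      gcongr
      exact hg.dist_le_mul a b
  refine ⟨hc.fixedPoint, ?_⟩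
  have := hc.fixedPoint_isFixedPt.eq
  exact eq_sub_iff_add_eq.1 this.symm

theorem LipschitzWith.image_ball_id_add_smul [NormedSpace ℝ X] [CompleteSpace X] {g : X → X}
    {K : NNReal} (hg : LipschitzWith K g) {r : ℝ} (hg0 : ∀ x, r ≤ ‖x‖ → g x = 0)
    {t : ℝ} (ht : 0 ≤ t) (htK : t * K < 1) :
    (fun x => x + t • g x) '' Metric.ball 0 r = Metric.ball 0 r := by
  have hcompl : (fun x => x + t • g x) '' (Metric.ball 0 r)ᶜ = (Metric.ball 0 r)ᶜ := by
    refine (Set.image_congr fun x hx => ?_).trans (Set.image_id _)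
    simp [hg0 x (by simpa using hx)]
  rw [← compl_inj_iff, ← Set.image_compl_eq
    ⟨hg.injective_id_add_smul ht htK, hg.surjective_id_add_smul ht htK⟩, hcompl]

/-- A Lipschitz function on a closed ball vanishing on its boundary remains Lipschitz when
extended by zero. -/
theorem LipschitzOnWith.indicator_closedBall [NormedSpace ℝ X] {F : Type*} [NormedAddCommGroup F]
    {g : X → F} {K : NNReal} {r : ℝ} (hr : 0 < r)
    (hg : LipschitzOnWith K g (Metric.closedBall 0 r)) (hg0 : ∀ x, ‖x‖ = r → g x = 0) :
    LipschitzWith K ((Metric.closedBall 0 r).indicator g) := by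
  have key : ∀ x ∈ Metric.closedBall (0 : X) r, ∀ y ∉ Metric.closedBall (0 : X) r,
      ‖g x‖ ≤ K * dist x y := by
    intro x hx y hy
    have hxr : ‖x‖ ≤ r := by simpa using hx
    have hyr : r < ‖y‖ := by simpa using hy
    have hdist : r - ‖x‖ ≤ dist x y := by
      rw [dist_comm, dist_eq_norm]
      linarith [norm_sub_norm_le y x]
    obtain ⟨z, hz, hxz⟩ : ∃ z, ‖z‖ = r ∧ dist x z ≤ r - ‖x‖ := by
      rcases eq_or_ne x 0 with rfl | hx0
      · have hy0 : ‖y‖ ≠ 0 := (hr.trans hyr).ne'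
        have hz : ‖(r / ‖y‖) • y‖ = r := by
          rw [norm_smul, norm_div, norm_norm, Real.norm_of_nonneg hr.le, div_mul_cancel₀ _ hy0]
        exact ⟨(r / ‖y‖) • y, hz, by simp [hz]⟩
      · have hpos := norm_pos_iff.2 hx0
        refine ⟨(r / ‖x‖) • x, ?_, ?_⟩
        · rw [norm_smul, norm_div, norm_norm, Real.norm_of_nonneg hr.le,
            div_mul_cancel₀ _ hpos.ne']
        · have : (r / ‖x‖) • x - x = (r / ‖x‖ - 1) • x := by rw [sub_smul, one_smul]
          rw [dist_comm, dist_eq_norm, this, norm_smul, Real.norm_of_nonneg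
            (sub_nonneg.2 ((one_le_div hpos).2 hxr)), sub_mul, div_mul_cancel₀ _ hpos.ne', one_mul]
    calc ‖g x‖ = dist (g x) (g z) := by rw [hg0 z hz, dist_zero_right]
      _ ≤ K * dist x z := hg.dist_le_mul x hx z (by simp [hz])
      _ ≤ K * dist x y := by gcongr; exact hxz.trans hdist
  refine LipschitzWith.of_dist_le_mul fun x y => ?_
  by_cases hx : x ∈ Metric.closedBall (0 : X) r <;> by_cases hy : y ∈ Metric.closedBall (0 : X) r
  · simpa [Set.indicator_of_mem hx, Set.indicator_of_mem hy] using hg.dist_le_mul x hx y hy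
  · simpa [Set.indicator_of_mem hx, Set.indicator_of_notMem hy] using key x hx y hy
  · simpa [Set.indicator_of_notMem hx, Set.indicator_of_mem hy, dist_comm] using key y hy x hx
  · simpa [Set.indicator_of_notMem hx, Set.indicator_of_notMem hy] using by positivity

end

open MeasureTheory in
/-- For a small perturbation of the identity that vanishes on the boundary of a ball, the integral
of the Jacobian determinant over the ball is the volume of the ball. -/
theorem setIntegral_det_one_add_smul_fderiv {X : Type*} [NormedAddCommGroup X] [NormedSpace ℝ X]
    [FiniteDimensional ℝ X] [MeasurableSpace X] [BorelSpace X] (μ : Measure X)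
    [μ.IsAddHaarMeasure] {r : ℝ} (hr : 0 < r) {g : X → X} {K : NNReal}
    (hg : LipschitzOnWith K g (Metric.closedBall 0 r)) (hg0 : ∀ x, ‖x‖ = r → g x = 0)
    (hd : ∀ x ∈ Metric.ball (0 : X) r, DifferentiableAt ℝ g x) {t : ℝ} (ht : 0 ≤ t)
    (htK : t * K < 1) :
    ∫ x in Metric.ball 0 r, (1 + t • fderiv ℝ g x).det ∂μ = μ.real (Metric.ball 0 r) := by
  have hext := hg.indicator_closedBall hr hg0
  have hext0 : ∀ x, r ≤ ‖x‖ → (Metric.closedBall 0 r).indicator g x = 0 := by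
    intro x hx
    rcases hx.eq_or_lt with h | h
    · rw [Set.indicator_of_mem (by simp [← h]), hg0 x h.symm]
    · exact Set.indicator_of_notMem (by simpa using h) _
  have hEq : Set.EqOn (fun x => x + t • (Metric.closedBall 0 r).indicator g x)
      (fun x => x + t • g x) (Metric.ball 0 r) := fun x hx => by
    simp only [Set.indicator_of_mem (Metric.ball_subset_closedBall hx)]
  have hinj : Set.InjOn (fun x => x + t • g x) (Metric.ball 0 r) :=
    (hext.injective_id_add_smul ht htK).injOn.congr hEq
  have himg : (fun x => x + t • g x) '' Metric.ball 0 r = Metric.ball 0 r := by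
    rw [← hEq.image_eq, hext.image_ball_id_add_smul hext0 ht htK]
  have hderiv : ∀ x ∈ Metric.ball (0 : X) r, HasFDerivWithinAt (fun x => x + t • g x)
      (1 + t • fderiv ℝ g x) (Metric.ball 0 r) x := fun x hx =>
    ((hasFDerivAt_id x).add ((hd x hx).hasFDerivAt.const_smul t)).hasFDerivWithinAt
  have hcv := integral_image_eq_integral_abs_det_fderiv_smul μ measurableSet_ball hderiv hinj
    fun _ => (1 : ℝ)
  rw [himg] at hcv
  have hpos : ∀ x ∈ Metric.ball (0 : X) r, 0 < (1 + t • fderiv ℝ g x).det := by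
    intro x hx
    refine ContinuousLinearMap.det_one_add_pos_of_norm_lt_one (lt_of_le_of_lt ?_ htK)
    rw [norm_smul, Real.norm_of_nonneg ht]
    gcongr
    exact norm_fderiv_le_of_lipschitzOn ℝ
      (Filter.mem_of_superset (Metric.isOpen_ball.mem_nhds hx) Metric.ball_subset_closedBall) hg
  calc ∫ x in Metric.ball 0 r, (1 + t • fderiv ℝ g x).det ∂μ
      = ∫ x in Metric.ball 0 r, |(1 + t • fderiv ℝ g x).det| • (1 : ℝ) ∂μ :=
        setIntegral_congr_fun measurableSet_ball fun x hx => by simp [abs_of_pos (hpos x hx)]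
    _ = μ.real (Metric.ball 0 r) := by rw [← hcv]; simp

open MeasureTheory in
/-- There is no continuously differentiable retraction `x ↦ x + g x` of a closed ball onto its
boundary sphere. -/
theorem not_forall_norm_add_eq_of_contDiffOn {X : Type*} [NormedAddCommGroup X]
    [InnerProductSpace ℝ X] [FiniteDimensional ℝ X] {r : ℝ} (hr : 0 < r) {g : X → X} {U : Set X}
    (hU : IsOpen U) (hBU : Metric.closedBall 0 r ⊆ U) (hg : ContDiffOn ℝ 1 g U)
    (hg0 : ∀ x, ‖x‖ = r → g x = 0) :
    ¬ ∀ x, ‖x‖ < r → ‖x + g x‖ = r := by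
  intro hnorm
  borelize X
  have hd : ∀ x ∈ Metric.ball (0 : X) r, DifferentiableAt ℝ g x := fun x hx =>
    (hg.differentiableOn one_ne_zero).differentiableAt
      (hU.mem_nhds (hBU (Metric.ball_subset_closedBall hx)))
  obtain ⟨K, hK⟩ := (hg.mono hBU).exists_lipschitzOnWith one_ne_zero
    (convex_closedBall 0 r) (isCompact_closedBall 0 r)
  have hdet0 : ∀ x ∈ Metric.ball (0 : X) r, (1 + fderiv ℝ g x).det = 0 := by
    intro x hx
    by_contra hne
    have hder : HasFDerivAt (fun x => x + g x) (1 + fderiv ℝ g x) x :=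
      (hasFDerivAt_id x).add (hd x hx).hasFDerivAt
    have hconst : (fun y => ‖y + g y‖ ^ 2) =ᶠ[nhds x] fun _ => r ^ 2 := by
      filter_upwards [Metric.isOpen_ball.mem_nhds hx] with y hy
      rw [hnorm y (by simpa using hy)]
    have hzero := hder.norm_sq.unique ((hasFDerivAt_const (r ^ 2) x).congr_of_eventuallyEq hconst)
    obtain ⟨v, hv⟩ : ∃ v, (1 + fderiv ℝ g x) v = x + g x :=
      ((1 + fderiv ℝ g x).toContinuousLinearEquivOfDetNeZero hne).surjective _
    have := congrArg (fun L : X →L[ℝ] ℝ => L v) hzero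
    have hxr := hnorm x (by simpa using hx)
    simp only [smul_apply, ContinuousLinearMap.comp_apply, hv, innerSL_apply_apply,
      real_inner_self_eq_norm_sq, hxr] at this
    simp [hr.ne'] at this
  let s := Finset.range (Module.finrank ℝ X + 1)
  let t : ℕ → ℝ := fun i => ((K + 1) * (i + 1))⁻¹
  have ht0 : ∀ i, 0 ≤ t i := fun i => by positivity
  have htK : ∀ i, t i * K < 1 := fun i => by
    have : (K : ℝ) < (K + 1) * (i + 1) := by
      nlinarith [K.coe_nonneg, (Nat.cast_nonneg i : (0 : ℝ) ≤ i)]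
    rw [inv_mul_lt_one₀ (by positivity)]
    exact this
  have htinj : Set.InjOn t s := fun i _ j _ hij => by
    have hK1 : (K : ℝ) + 1 ≠ 0 := by positivity
    simpa [t, hK1] using hij
  have hint : ∀ c : ℝ, IntegrableOn (fun x => (1 + c • fderiv ℝ g x).det) (Metric.ball 0 r)
      (volume : Measure X) := by
    intro c
    refine (ContinuousOn.integrableOn_compact (isCompact_closedBall 0 r) ?_).mono_set
      Metric.ball_subset_closedBall
    have hcont := (hg.continuousOn_fderiv_of_isOpen hU le_rfl).mono hBU
    exact ContinuousLinearMap.continuous_det.comp_continuousOn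
      (continuousOn_const.add (hcont.const_smul c))
  have hvol : (volume : Measure X).real (Metric.ball 0 r) = 0 := by
    calc (volume : Measure X).real (Metric.ball 0 r)
        = ∑ i ∈ s, volume.real (Metric.ball (0 : X) r) * (Lagrange.basis s t i).eval 1 := by
          rw [← Finset.mul_sum, ← Polynomial.eval_finsetSum,
            Lagrange.sum_basis htinj ⟨0, by simp [s]⟩]
          simp
      _ = ∑ i ∈ s, ∫ x in Metric.ball (0 : X) r,
            (1 + t i • fderiv ℝ g x).det * (Lagrange.basis s t i).eval 1 := by
          refine Finset.sum_congr rfl fun i _ => ?_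
          rw [integral_mul_const,
            setIntegral_det_one_add_smul_fderiv volume hr hK hg0 hd (ht0 i) (htK i)]
      _ = ∫ x in Metric.ball (0 : X) r, (1 + fderiv ℝ g x).det := by
          rw [← integral_finsetSum _ fun i _ => (hint (t i)).mul_const _]
          refine integral_congr_ae (Filter.Eventually.of_forall fun x => ?_)
          exact (LinearMap.det_one_add_eq_sum_lagrange_basis htinj (by simp [s])
            (fderiv ℝ g x : X →ₗ[ℝ] X)).symm
      _ = 0 := by
          rw [setIntegral_congr_fun measurableSet_ball hdet0]
          simp
  have := Metric.measure_ball_pos (volume : Measure X) 0 hr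
  exact (ENNReal.toReal_pos this.ne' measure_ball_lt_top.ne).ne' hvol

/-- A continuously differentiable vector field pointing strictly outward on a sphere has a zero in
the ball: otherwise, pushing each point along the field until it reaches the sphere would be a
retraction. -/
theorem exists_eq_zero_of_contDiff_of_inner_pos {X : Type*} [NormedAddCommGroup X]
    [InnerProductSpace ℝ X] [FiniteDimensional ℝ X] {r : ℝ} (hr : 0 < r) {p : X → X}
    (hp : ContDiff ℝ 1 p) (hpos : ∀ x, ‖x‖ = r → 0 < ⟪p x, x⟫) :
    ∃ x, p x = 0 ∧ ‖x‖ ≤ r := by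
  by_contra! hne
  let D : X → ℝ := fun x => ⟪p x, x⟫ ^ 2 + ‖p x‖ ^ 2 * (r ^ 2 - ‖x‖ ^ 2)
  let σ : X → ℝ := fun x => (√(D x) - ⟪p x, x⟫) / ‖p x‖ ^ 2
  let U : Set X := {x | 0 < D x} ∩ {x | p x ≠ 0}
  have hinner : ContDiff ℝ 1 fun x => ⟪p x, x⟫ := hp.inner ℝ contDiff_id
  have hnormsq : ContDiff ℝ 1 fun x => ‖p x‖ ^ 2 := hp.norm_sq ℝ
  have hD : ContDiff ℝ 1 D :=
    (hinner.pow 2).add (hnormsq.mul (contDiff_const.sub (contDiff_id.norm_sq ℝ)))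
  have hU : IsOpen U := (isOpen_lt continuous_const hD.continuous).inter
    (isOpen_ne_fun hp.continuous continuous_const)
  have hBU : Metric.closedBall 0 r ⊆ U := by
    intro x hx
    have hxr : ‖x‖ ≤ r := by simpa using hx
    have hpx : p x ≠ 0 := fun h => (hne x h).not_ge hxr
    refine ⟨?_, hpx⟩
    have hp2 : 0 < ‖p x‖ ^ 2 := by positivity
    rcases hxr.eq_or_lt with h | h
    · have := hpos x h
      simp only [Set.mem_ofPred_eq, D, h, sub_self, mul_zero, add_zero]
      positivity
    · have : 0 < r ^ 2 - ‖x‖ ^ 2 := by nlinarith [norm_nonneg x]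
      simp only [Set.mem_ofPred_eq, D]
      positivity
  have hσ : ContDiffOn ℝ 1 σ U :=
    ((hD.contDiffOn.sqrt fun x hx => hx.1.ne').sub hinner.contDiffOn).div hnormsq.contDiffOn
      fun x hx => pow_ne_zero 2 (norm_ne_zero_iff.2 hx.2)
  refine not_forall_norm_add_eq_of_contDiffOn hr hU hBU (hσ.smul hp.contDiffOn)
    (fun x hx => ?_) fun x hx => ?_
  · have : σ x = 0 := by simp [σ, D, hx, Real.sqrt_sq (hpos x hx).le]
    simp [this]
  · have hxU := hBU (show x ∈ Metric.closedBall 0 r by simpa using hx.le)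
    have hp2 : ‖p x‖ ^ 2 ≠ 0 := pow_ne_zero 2 (norm_ne_zero_iff.2 hxU.2)
    have hσx : σ x * ‖p x‖ ^ 2 + ⟪p x, x⟫ = √(D x) := by
      simp only [σ, div_mul_cancel₀ _ hp2]
      ring
    have hsq : (σ x * ‖p x‖ ^ 2 + ⟪p x, x⟫) ^ 2 = D x := by
      rw [hσx, Real.sq_sqrt (le_of_lt hxU.1)]
    have hexp : ‖x + σ x • p x‖ ^ 2 = ‖x‖ ^ 2 + 2 * (σ x * ⟪p x, x⟫) + σ x ^ 2 * ‖p x‖ ^ 2 := by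
      rw [norm_add_sq_real, inner_smul_right, real_inner_comm, norm_smul, mul_pow,
        Real.norm_eq_abs, sq_abs]
    have : ‖x + σ x • p x‖ ^ 2 = r ^ 2 := by
      refine mul_left_cancel₀ hp2 ?_
      rw [hexp]
      simp only [D] at hsq
      linear_combination hsq
    exact (pow_left_inj₀ (norm_nonneg _) hr.le two_ne_zero).1 this

theorem Continuous.exists_contDiff_forall_mem_dist_le {E F : Type*} [NormedAddCommGroup E]
    [NormedSpace ℝ E] [FiniteDimensional ℝ E] [NormedAddCommGroup F] [NormedSpace ℝ F]
    [CompleteSpace F] {f : E → F} (hf : Continuous f) {s : Set E} (hs : IsCompact s) {ε : ℝ}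
    (hε : 0 < ε) : ∃ p : E → F, ContDiff ℝ 1 p ∧ ∀ x ∈ s, dist (p x) (f x) ≤ ε := by
  have hunif := hs.uniformContinuousAt_of_continuousAt f (fun x _ => hf.continuousAt)
    (Metric.dist_mem_uniformity hε)
  obtain ⟨δ, hδ, hδs⟩ := Metric.mem_uniformity_dist.1 hunif
  obtain ⟨p, hp, hpf⟩ := hf.exists_contDiff_dist_le_of_forall_mem_ball_dist_le hδ
  refine ⟨p, hp.of_le (mod_cast le_top), fun x hx => hpf x ε fun y hy => ?_⟩
  rw [dist_comm]
  exact (hδs (by rwa [dist_comm, ← Metric.mem_ball]) hx).le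

/-- Corollary of Brouwer's fixed point theorem: a continuous map `f` on a
finite-dimensional real inner product space whose inner product with the
identity is nonnegative on the sphere of radius `r` has a zero in the closed
ball of radius `r`. -/
theorem stmt_5 {X : Type*} [NormedAddCommGroup X] [InnerProductSpace ℝ X]
    [FiniteDimensional ℝ X] (f : X → X) (hf : Continuous f) (r : ℝ) (hr : 0 < r)
    (h : ∀ v : X, ‖v‖ = r → 0 ≤ ⟪f v, v⟫) :
    ∃ v₁ : X, f v₁ = 0 ∧ ‖v₁‖ ≤ r := by
  by_contra! hne
  obtain ⟨x₀, hx₀, hmin⟩ := (isCompact_closedBall (0 : X) r).exists_isMinOn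
    ⟨0, by simpa using hr.le⟩ hf.norm.continuousOn
  have hδ : 0 < ‖f x₀‖ := norm_pos_iff.2 fun h0 => (hne x₀ h0).not_ge (by simpa using hx₀)
  set δ := ‖f x₀‖
  obtain ⟨p, hp, hpf⟩ := Continuous.exists_contDiff_forall_mem_dist_le
    (hf.add (continuous_id.const_smul (δ / (2 * r)))) (isCompact_closedBall (0 : X) r)
    (show 0 < δ / 4 by positivity)
  have hclose : ∀ x, ‖x‖ ≤ r → ‖p x - (f x + (δ / (2 * r)) • x)‖ ≤ δ / 4 := fun x hx => by
    simpa [dist_eq_norm] using hpf x (by simpa using hx)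
  obtain ⟨x, hpx, hx⟩ := exists_eq_zero_of_contDiff_of_inner_pos hr hp fun x hx => by
    have hcs := (abs_le.1 (abs_real_inner_le_norm (p x - (f x + (δ / (2 * r)) • x)) x)).1
    rw [inner_sub_left, inner_add_left, real_inner_smul_left, real_inner_self_eq_norm_sq, hx] at hcs
    have hmul : δ / (2 * r) * r ^ 2 = δ / 2 * r := by field_simp
    nlinarith [h x hx, mul_le_mul_of_nonneg_right (hclose x hx.le) hr.le, mul_pos hδ hr]
  have hfx : δ ≤ ‖f x‖ := hmin (by simpa using hx)
  have hsmul : ‖(δ / (2 * r)) • x‖ ≤ δ / 2 := by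
    rw [norm_smul, Real.norm_of_nonneg (by positivity)]
    calc δ / (2 * r) * ‖x‖ ≤ δ / (2 * r) * r := by gcongr
      _ = δ / 2 := by field_simp
  have hsum := hclose x hx
  rw [hpx, zero_sub, norm_neg] at hsum
  have htri := norm_sub_le (f x + (δ / (2 * r)) • x) ((δ / (2 * r)) • x)
  rw [add_sub_cancel_right] at htri
  linarith
end

section
/- Let E be a real inner product space, let k > 0, β > 0, and α > 0 be real numbers with e^{2αk} ≤ 1 + kβ, and let Y : ℕ → E be a sequence such that for every n ≥ 1, ⟨Yₙ − Yₙ₋₁, Yₙ⟩ + (kβ/2) ‖Yₙ‖² ≤ 0. Then for every natural number M, ‖Y_M‖² ≤ e^{−2αMk} ‖Y₀‖². -/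
open scoped RealInnerProductSpace

/-- One step of the backward Euler energy estimate. -/
theorem one_add_mul_norm_sq_le_of_inner_sub_add_le {E : Type*} [NormedAddCommGroup E]
    [InnerProductSpace ℝ E] {c : ℝ} {x y : E} (h : ⟪x - y, x⟫ + c / 2 * ‖x‖ ^ 2 ≤ 0) :
    (1 + c) * ‖x‖ ^ 2 ≤ ‖y‖ ^ 2 := by
  have hsub := norm_sub_sq_real x y
  rw [inner_sub_left, real_inner_self_eq_norm_sq, real_inner_comm] at h
  linarith [sq_nonneg ‖x - y‖]

/-- Abstract discrete exponential decay estimate for the backward Euler scheme: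
if `e^{2αk} ≤ 1 + kβ` and `⟨Yₙ − Yₙ₋₁, Yₙ⟩ + (kβ/2)‖Yₙ‖² ≤ 0` for all `n ≥ 1`,
then `‖Y_M‖² ≤ e^{−2αMk} ‖Y₀‖²` for every `M`. -/
theorem stmt_15 {E : Type*} [NormedAddCommGroup E] [InnerProductSpace ℝ E]
    (k β α : ℝ) (hk : 0 < k) (hβ : 0 < β) (hα : 0 < α)
    (hstep : Real.exp (2 * α * k) ≤ 1 + k * β)
    (Y : ℕ → E)
    (hY : ∀ n : ℕ, 1 ≤ n → ⟪Y n - Y (n - 1), Y n⟫ + (k * β / 2) * ‖Y n‖ ^ 2 ≤ 0) :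
    ∀ M : ℕ, ‖Y M‖ ^ 2 ≤ Real.exp (-(2 * α * M * k)) * ‖Y 0‖ ^ 2 := by
  intro M
  induction M with
  | zero => simp
  | succ n ih =>
    have hdecay : Real.exp (2 * α * k) * ‖Y (n + 1)‖ ^ 2 ≤ ‖Y n‖ ^ 2 :=
      (mul_le_mul_of_nonneg_right hstep (sq_nonneg _)).trans
        (one_add_mul_norm_sq_le_of_inner_sub_add_le (hY (n + 1) n.succ_pos))
    calc ‖Y (n + 1)‖ ^ 2
        = Real.exp (-(2 * α * k)) * (Real.exp (2 * α * k) * ‖Y (n + 1)‖ ^ 2) := by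
          rw [← mul_assoc, ← Real.exp_add, neg_add_cancel, Real.exp_zero, one_mul]
      _ ≤ Real.exp (-(2 * α * k)) * (Real.exp (-(2 * α * n * k)) * ‖Y 0‖ ^ 2) :=
          mul_le_mul_of_nonneg_left (hdecay.trans ih) (Real.exp_nonneg _)
      _ = Real.exp (-(2 * α * (n + 1 : ℕ) * k)) * ‖Y 0‖ ^ 2 := by
          rw [← mul_assoc, ← Real.exp_add]
          push_cast
          ring_nf
end
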